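/- arXiv:1204.5251 — 5 statements merged into one kernel-verified Lean document; each statement's English description precedes it below -/
import Mathlib

section
/- For every prime q, the natural density d(q) of M(q) exists and equals 1 - (1 - 1/q) · ∏_{p prime, p ≠ q} [1 - (1 - 1/p) · Σ_{m ∈ M(q)} 1/p^m], where the product is over all primes p different from q. -/
open Filter Topology

/-- `TowerMem q n` means that the prime `q` occurs somewhere in the tower
factorization of the positive integer `n`:  `1 ∉ M(q)`, and for `n ≥ 2`,
`n ∈ M(q)` iff `q ∣ n` or some exponent in the prime factorization of `n`
lies in `M(q)`. -/
inductive TowerMem (q : ℕ) : ℕ → Prop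
  | base (n : ℕ) (hn : 2 ≤ n) (hdvd : q ∣ n) : TowerMem q n
  | step (n p : ℕ) (hn : 2 ≤ n) (hp : p.Prime) (hdvd : p ∣ n)
      (hexp : TowerMem q (n.factorization p)) : TowerMem q n

open Classical in
/-- The proportion of the integers `{1, …, N}` that lie in `M(q)`. -/
noncomputable def towerRatio (q N : ℕ) : ℝ :=
  (((Finset.Icc 1 N).filter fun n => TowerMem q n).card : ℝ) / (N : ℝ)

open Classical in
/-- The proportion of the integers `{1, …, N}` that lie in `s`. -/
noncomputable def setRatio (s : Set ℕ) (N : ℕ) : ℝ :=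
  (((Finset.Icc 1 N).filter fun n => n ∈ s).card : ℝ) / (N : ℝ)

theorem setRatio_eq (s : Set ℕ) [DecidablePred (· ∈ s)] (N : ℕ) :
    setRatio s N = (((Finset.Icc 1 N).filter fun n => n ∈ s).card : ℝ) / (N : ℝ) := by
  unfold setRatio
  congr!

theorem setRatio_nonneg (s : Set ℕ) (N : ℕ) : 0 ≤ setRatio s N := by
  unfold setRatio; positivity

theorem setRatio_mono_of_pos {s t : Set ℕ} (h : ∀ n, 1 ≤ n → n ∈ s → n ∈ t) (N : ℕ) :
    setRatio s N ≤ setRatio t N := by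
  classical
  unfold setRatio
  gcongr ((?_ : ℕ) : ℝ) / _
  refine Finset.card_le_card fun n hn => ?_
  simp only [Finset.mem_filter, Finset.mem_Icc] at hn ⊢
  exact ⟨hn.1, h n hn.1.1 hn.2⟩

theorem setRatio_congr_of_pos {s t : Set ℕ} (h : ∀ n, 1 ≤ n → (n ∈ s ↔ n ∈ t)) (N : ℕ) :
    setRatio s N = setRatio t N :=
  le_antisymm (setRatio_mono_of_pos (fun n hn => (h n hn).1) N)
    (setRatio_mono_of_pos (fun n hn => (h n hn).2) N)

theorem setRatio_diff {s t : Set ℕ} (h : t ⊆ s) (N : ℕ) :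
    setRatio (s \ t) N = setRatio s N - setRatio t N := by
  classical
  simp only [setRatio_eq]
  rw [← sub_div, eq_comm]
  congr 1
  rw [sub_eq_iff_eq_add, ← Nat.cast_add, ← Finset.card_union_of_disjoint]
  · congr 2
    ext n
    simp only [Finset.mem_filter, Finset.mem_union, Set.mem_sdiff]
    have := @h n
    tauto
  · rw [Finset.disjoint_left]
    intro n hn hn'
    exact (Finset.mem_filter.1 hn).2.2 (Finset.mem_filter.1 hn').2

theorem setRatio_biUnion_le {ι : Type*} (I : Finset ι) (s : ι → Set ℕ) (N : ℕ) :
    setRatio (⋃ i ∈ I, s i) N ≤ ∑ i ∈ I, setRatio (s i) N := by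
  classical
  unfold setRatio
  rw [← Finset.sum_div]
  gcongr
  rw [← Nat.cast_sum]
  refine Nat.cast_le.2 (le_trans (Finset.card_le_card fun n hn => ?_) Finset.card_biUnion_le)
  simp only [Finset.mem_filter, Set.mem_iUnion, Finset.mem_biUnion] at hn ⊢
  obtain ⟨h, i, hi, hs⟩ := hn
  exact ⟨i, hi, h, hs⟩

theorem setRatio_dvd_le (k N : ℕ) : setRatio {n | k ∣ n} N ≤ 1 / (k : ℝ) := by
  classical
  rcases N.eq_zero_or_pos with rfl | hN
  · simp [setRatio]
  have h : ((Finset.Icc 1 N).filter fun n => n ∈ {n | k ∣ n}).card = N / k := by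
    rw [← Nat.Ioc_filter_dvd_card_eq_div]; rfl
  have hN' : (0 : ℝ) < N := by exact_mod_cast hN
  rw [setRatio_eq, h, div_le_iff₀ hN']
  calc ((N / k : ℕ) : ℝ) ≤ (N : ℝ) / k := Nat.cast_div_le
    _ = 1 / (k : ℝ) * N := by ring

theorem tendsto_setRatio_univ : Tendsto (setRatio Set.univ) atTop (𝓝 1) := by
  refine tendsto_const_nhds.congr' ?_
  filter_upwards [eventually_ge_atTop 1] with N hN
  have : (N : ℝ) ≠ 0 := by positivity
  simp [setRatio, this]

theorem tendsto_setRatio_inter_dvd {A : Set ℕ} {d : ℝ} {k : ℕ} (hk : 0 < k)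
    (hA : ∀ n, k * n ∈ A ↔ n ∈ A) (hd : Tendsto (setRatio A) atTop (𝓝 d)) :
    Tendsto (setRatio {n | n ∈ A ∧ k ∣ n}) atTop (𝓝 (d / k)) := by
  classical
  have hcard (N : ℕ) : ((Finset.Icc 1 N).filter fun n => n ∈ {n | n ∈ A ∧ k ∣ n}).card =
      ((Finset.Icc 1 (N / k)).filter fun n => n ∈ A).card := by
    symm
    refine Finset.card_bij (fun n _ => k * n) ?_ ?_ ?_
    · intro n hn
      simp only [Finset.mem_filter, Finset.mem_Icc, Set.mem_ofPred_eq] at hn ⊢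
      rw [Nat.le_div_iff_mul_le hk] at hn
      refine ⟨⟨Nat.mul_pos hk hn.1.1, by linarith [hn.1.2]⟩, (hA n).2 hn.2, dvd_mul_right _ _⟩
    · intro a _ b _ hab
      exact Nat.eq_of_mul_eq_mul_left hk hab
    · intro n hn
      simp only [Finset.mem_filter, Finset.mem_Icc, Set.mem_ofPred_eq] at hn
      obtain ⟨⟨h1, h2⟩, h3, m, rfl⟩ := hn
      refine ⟨m, ?_, rfl⟩
      simp only [Finset.mem_filter, Finset.mem_Icc]
      rw [Nat.le_div_iff_mul_le hk]
      exact ⟨⟨Nat.pos_of_mul_pos_left h1, by linarith⟩, (hA m).1 h3⟩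
  have hdiv : Tendsto (fun N : ℕ => N / k) atTop atTop := Nat.tendsto_div_const_atTop hk.ne'
  have hfloor : Tendsto (fun N : ℕ => ((N / k : ℕ) : ℝ) / N) atTop (𝓝 (1 / k)) := by
    have := (tendsto_nat_floor_mul_div_atTop (R := ℝ) (a := 1 / k) (by positivity)).comp
      tendsto_natCast_atTop_atTop
    refine this.congr fun N => ?_
    simp only [Function.comp_apply]
    rw [one_div_mul_eq_div, Nat.floor_div_eq_div]
  have := (hd.comp hdiv).mul hfloor
  rw [mul_one_div] at this
  refine this.congr' ?_
  filter_upwards [eventually_ge_atTop k] with N hN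
  have h1 : ((N / k : ℕ) : ℝ) ≠ 0 := by
    have := Nat.div_pos hN hk
    positivity
  simp only [Function.comp_apply, setRatio_eq]
  rw [hcard, div_mul_div_cancel₀ h1]

theorem hasSum_setRatio_fiber (A : Set ℕ) (v : ℕ → ℕ) (S : ℕ → Prop) (N : ℕ) :
    HasSum (fun m : {m // S m} => setRatio {n | n ∈ A ∧ v n = m} N)
      (setRatio {n | n ∈ A ∧ S (v n)} N) := by
  classical
  simp only [setRatio_eq, Finset.card_filter, Nat.cast_sum, Set.mem_ofPred_eq]
  refine HasSum.div_const (hasSum_sum fun n _ => ?_) _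
  by_cases h : n ∈ A ∧ S (v n)
  · have := hasSum_ite_eq (⟨v n, h.2⟩ : {m // S m}) (1 : ℝ)
    simpa [h.1, h.2, Subtype.ext_iff, eq_comm] using this
  · have h' (m : {m // S m}) : ¬ (n ∈ A ∧ v n = m) := fun h' => h ⟨h'.1, h'.2 ▸ m.2⟩
    simpa only [h, h', if_false, Nat.cast_zero] using hasSum_zero

theorem tendsto_setRatio_factorization {A : Set ℕ} {d : ℝ} {p : ℕ} (hp : p.Prime)
    (hA : ∀ n, p * n ∈ A ↔ n ∈ A) (hd : Tendsto (setRatio A) atTop (𝓝 d)) (S : ℕ → Prop) :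
    Tendsto (setRatio {n | n ∈ A ∧ S (n.factorization p)}) atTop
      (𝓝 (d * ((1 - 1 / (p : ℝ)) * ∑' m : {m // S m}, 1 / (p : ℝ) ^ (m : ℕ)))) := by
  have hp0 : (0 : ℝ) < p := by exact_mod_cast hp.pos
  have hApow (m n : ℕ) : p ^ m * n ∈ A ↔ n ∈ A := by
    induction m with
    | zero => simp
    | succ m ih => rw [pow_succ', mul_assoc, hA, ih]
  have hsplit (m N : ℕ) : setRatio {n | n ∈ A ∧ n.factorization p = m} N =
      setRatio {n | n ∈ A ∧ p ^ m ∣ n} N - setRatio {n | n ∈ A ∧ p ^ (m + 1) ∣ n} N := by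
    rw [← setRatio_diff]
    · refine setRatio_congr_of_pos (fun n hn => ?_) N
      have hn0 : n ≠ 0 := by omega
      simp only [Set.mem_ofPred_eq, Set.mem_sdiff, hp.pow_dvd_iff_le_factorization hn0]
      constructor
      · rintro ⟨h, rfl⟩
        exact ⟨⟨h, le_rfl⟩, by rintro ⟨-, h⟩; omega⟩
      · rintro ⟨⟨h, h1⟩, h2⟩
        refine ⟨h, ?_⟩
        by_contra h3
        exact h2 ⟨h, by omega⟩
    · rintro n ⟨h, h1⟩
      exact ⟨h, (pow_dvd_pow p (Nat.le_succ m)).trans h1⟩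
  have hfiber (m : ℕ) : Tendsto (setRatio {n | n ∈ A ∧ n.factorization p = m}) atTop
      (𝓝 (d * (1 - 1 / (p : ℝ)) * (1 / (p : ℝ) ^ m))) := by
    have h := (tendsto_setRatio_inter_dvd (pow_pos hp.pos m) (hApow m) hd).sub
      (tendsto_setRatio_inter_dvd (pow_pos hp.pos (m + 1)) (hApow (m + 1)) hd)
    convert h using 2
    · exact hsplit m _
    · push_cast
      field_simp
      ring
  rw [← mul_assoc, ← tsum_mul_left]
  have hsum : Summable fun m : {m // S m} => 1 / (p : ℝ) ^ (m : ℕ) := by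
    have : Summable fun m : ℕ => 1 / (p : ℝ) ^ m := by
      simp_rw [← one_div_pow]
      refine summable_geometric_of_lt_one (by positivity) ?_
      rw [div_lt_one hp0]
      exact_mod_cast hp.one_lt
    exact this.comp_injective Subtype.val_injective
  refine (tendsto_tsum_of_dominated_convergence hsum (fun m => hfiber m)
    (Eventually.of_forall fun N m => ?_)).congr fun N =>
      (hasSum_setRatio_fiber A (fun n => n.factorization p) S N).tsum_eq
  rw [Real.norm_of_nonneg (setRatio_nonneg _ _)]
  refine (setRatio_mono_of_pos (t := {n | p ^ (m : ℕ) ∣ n}) ?_ N).trans ?_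
  · rintro n - ⟨-, h⟩
    rw [Set.mem_ofPred_eq, ← h]
    exact Nat.ordProj_dvd n p
  · exact_mod_cast setRatio_dvd_le (p ^ (m : ℕ)) N

theorem TowerMem.two_le {q n : ℕ} (h : TowerMem q n) : 2 ≤ n := by
  cases h <;> assumption

theorem towerMem_iff {q n : ℕ} (hq : q.Prime) (hn : 1 ≤ n) :
    TowerMem q n ↔ q ∣ n ∨ ∃ p : {p : ℕ // p.Prime ∧ p ≠ q}, TowerMem q (n.factorization p) := by
  have hn0 : n ≠ 0 := by omega
  constructor
  · intro h
    cases h with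
    | base _ hn hd => exact .inl hd
    | step _ p hn hp hd he =>
      by_cases hpq : p = q
      · exact .inl (hpq ▸ hd)
      · exact .inr ⟨⟨p, hp, hpq⟩, he⟩
  · rintro (h | ⟨⟨p, hp, hpq⟩, h⟩)
    · exact .base n (hq.two_le.trans (Nat.le_of_dvd hn h)) h
    · have hd : p ∣ n := Nat.dvd_of_factorization_pos (by have := h.two_le; simp only at this; omega)
      exact .step n p (hp.two_le.trans (Nat.le_of_dvd hn hd)) hp hd h

/-- The factor by which the exponents of `p` contribute to the density of `M(q)`. -/
noncomputable def towerWeight (q p : ℕ) : ℝ :=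
  (1 - 1 / (p : ℝ)) * ∑' m : {m : ℕ // TowerMem q m}, 1 / (p : ℝ) ^ (m : ℕ)

theorem setRatio_towerMem_factorization_le (q p N : ℕ) :
    setRatio {n | TowerMem q (n.factorization p)} N ≤ 1 / (p : ℝ) ^ 2 := by
  refine (setRatio_mono_of_pos (t := {n | p ^ 2 ∣ n}) ?_ N).trans ?_
  · intro n _ h
    exact (pow_dvd_pow p (TowerMem.two_le h)).trans (Nat.ordProj_dvd n p)
  · exact_mod_cast setRatio_dvd_le (p ^ 2) N

theorem towerWeight_nonneg (q : ℕ) {p : ℕ} (hp : p.Prime) : 0 ≤ towerWeight q p := by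
  have hp1 : (1 : ℝ) ≤ p := by exact_mod_cast hp.one_le
  refine mul_nonneg (sub_nonneg.2 ?_) (tsum_nonneg fun m => by positivity)
  exact (div_le_one (by positivity)).2 hp1

theorem towerWeight_le (q : ℕ) {p : ℕ} (hp : p.Prime) : towerWeight q p ≤ 1 / (p : ℝ) ^ 2 := by
  have h := tendsto_setRatio_factorization hp (A := Set.univ) (by simp) tendsto_setRatio_univ
    (TowerMem q)
  rw [one_mul] at h
  refine le_of_tendsto' h fun N => ?_
  simpa using setRatio_towerMem_factorization_le q p N

/-- The integers prime to `q` none of whose exponents at the primes in `T` lies in `M(q)`. -/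
def towerAvoid (q : ℕ) (T : Finset {p : ℕ // p.Prime ∧ p ≠ q}) : Set ℕ :=
  {n | ¬ q ∣ n ∧ ∀ p ∈ T, ¬ TowerMem q (n.factorization p)}

theorem mul_mem_towerAvoid_iff {q : ℕ} (hq : q.Prime)
    {T : Finset {p : ℕ // p.Prime ∧ p ≠ q}} {p : {p : ℕ // p.Prime ∧ p ≠ q}} (hpT : p ∉ T)
    (n : ℕ) : (p : ℕ) * n ∈ towerAvoid q T ↔ n ∈ towerAvoid q T := by
  obtain ⟨p, hp, hpq⟩ := p
  have hqp : ¬ q ∣ p := fun h => hpq ((Nat.prime_dvd_prime_iff_eq hq hp).1 h).symm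
  simp only [towerAvoid, Set.mem_ofPred_eq, hq.dvd_mul, hqp, false_or]
  rcases eq_or_ne n 0 with rfl | hn
  · simp
  refine and_congr_right fun _ => forall₂_congr fun r hr => ?_
  have hrp : p ≠ r := by
    rintro rfl
    exact hpT hr
  rw [Nat.factorization_mul hp.ne_zero hn, Finsupp.add_apply, hp.factorization,
    Finsupp.single_eq_of_ne hrp.symm, zero_add]

theorem tendsto_setRatio_towerAvoid {q : ℕ} (hq : q.Prime)
    (T : Finset {p : ℕ // p.Prime ∧ p ≠ q}) :
    Tendsto (setRatio (towerAvoid q T)) atTop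
      (𝓝 ((1 - 1 / (q : ℝ)) * ∏ p ∈ T, (1 - towerWeight q p))) := by
  classical
  induction T using Finset.induction_on with
  | empty =>
    have h := tendsto_setRatio_univ.sub
      (tendsto_setRatio_inter_dvd hq.pos (A := Set.univ) (by simp) tendsto_setRatio_univ)
    rw [Finset.prod_empty, mul_one]
    refine h.congr fun N => ?_
    rw [← setRatio_diff (Set.subset_univ _)]
    exact setRatio_congr_of_pos (fun n _ => by simp [towerAvoid]) N
  | insert p T hpT ih =>
    have h := ih.sub (tendsto_setRatio_factorization p.2.1 (mul_mem_towerAvoid_iff hq hpT) ih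
      (TowerMem q))
    rw [← mul_one_sub, mul_assoc, mul_comm (∏ _ ∈ T, _)] at h
    rw [Finset.prod_insert hpT]
    refine h.congr fun N => ?_
    rw [← setRatio_diff fun n hn => hn.1]
    refine setRatio_congr_of_pos (fun n _ => ?_) N
    simp only [towerAvoid, Set.mem_sdiff, Set.mem_ofPred_eq, Finset.forall_mem_insert]
    tauto

theorem summable_one_div_sq_primes_ne (q : ℕ) :
    Summable fun p : {p : ℕ // p.Prime ∧ p ≠ q} => 1 / ((p : ℕ) : ℝ) ^ 2 :=
  (Real.summable_one_div_nat_pow.2 one_lt_two).comp_injective Subtype.val_injective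

theorem setRatio_not_towerMem_le {q : ℕ} (hq : q.Prime)
    (T : Finset {p : ℕ // p.Prime ∧ p ≠ q}) (N : ℕ) :
    setRatio {n | ¬ TowerMem q n} N ≤ setRatio (towerAvoid q T) N := by
  refine setRatio_mono_of_pos (fun n hn h => ?_) N
  rw [Set.mem_ofPred_eq, towerMem_iff hq hn, not_or, not_exists] at h
  exact ⟨h.1, fun p _ => h.2 p⟩

theorem setRatio_towerAvoid_sub_le {q : ℕ} (hq : q.Prime)
    (T : Finset {p : ℕ // p.Prime ∧ p ≠ q}) (N : ℕ) :
    setRatio (towerAvoid q T) N - setRatio {n | ¬ TowerMem q n} N ≤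
      ∑' p : {p // p ∉ T}, 1 / (((p : {p : ℕ // p.Prime ∧ p ≠ q}) : ℕ) : ℝ) ^ 2 := by
  classical
  -- Only primes up to `N` matter in `[1, N]`, so a finite union bound suffices.
  let I : Finset {p : {p : ℕ // p.Prime ∧ p ≠ q} // p ∉ T} :=
    Finset.subtype _ (Finset.subtype _ (Finset.Icc 1 N))
  let s : {p : {p : ℕ // p.Prime ∧ p ≠ q} // p ∉ T} → Set ℕ :=
    fun p => {n | TowerMem q (n.factorization p)}
  have hs : Summable fun p : {p // p ∉ T} =>
      1 / (((p : {p : ℕ // p.Prime ∧ p ≠ q}) : ℕ) : ℝ) ^ 2 :=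
    (summable_one_div_sq_primes_ne q).comp_injective Subtype.val_injective
  calc setRatio (towerAvoid q T) N - setRatio {n | ¬ TowerMem q n} N
      ≤ setRatio (⋃ p ∈ I, s p) N := ?_
    _ ≤ ∑ p ∈ I, setRatio (s p) N := setRatio_biUnion_le I s N
    _ ≤ ∑ p ∈ I, 1 / (((p : {p : ℕ // p.Prime ∧ p ≠ q}) : ℕ) : ℝ) ^ 2 :=
      Finset.sum_le_sum fun p _ => setRatio_towerMem_factorization_le q p N
    _ ≤ _ := hs.sum_le_tsum I fun p _ => by positivity
  rw [sub_le_iff_le_add]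
  unfold setRatio
  rw [← add_div]
  gcongr
  rw [← Nat.cast_add]
  refine Nat.cast_le.2 (le_trans (Finset.card_le_card fun n hn => ?_) (Finset.card_union_le _ _))
  simp only [Finset.mem_filter, Finset.mem_union, Finset.mem_Icc, Set.mem_iUnion] at hn ⊢
  obtain ⟨⟨h1, hN⟩, hqn, hT⟩ := hn
  by_cases hM : TowerMem q n
  · obtain ⟨p, hp⟩ := ((towerMem_iff hq h1).1 hM).resolve_left hqn
    refine .inl ⟨⟨h1, hN⟩, ⟨p, fun hpT => hT p hpT hp⟩, ?_, hp⟩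
    have hd : (p : ℕ) ∣ n := Nat.dvd_of_factorization_pos (by have := hp.two_le; omega)
    simpa [I] using ⟨p.2.1.one_le, (Nat.le_of_dvd h1 hd).trans hN⟩
  · exact .inr ⟨⟨h1, hN⟩, hM⟩

theorem tendsto_setRatio_not_towerMem {q : ℕ} (hq : q.Prime) :
    Tendsto (setRatio {n | ¬ TowerMem q n}) atTop
      (𝓝 ((1 - 1 / (q : ℝ)) * ∏' p : {p : ℕ // p.Prime ∧ p ≠ q}, (1 - towerWeight q p))) := by
  have hsum : Summable fun p : {p : ℕ // p.Prime ∧ p ≠ q} => -towerWeight q p :=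
    (Summable.of_nonneg_of_le (fun p => towerWeight_nonneg q p.2.1)
      (fun p => towerWeight_le q p.2.1) (summable_one_div_sq_primes_ne q)).neg
  have hmul : Multipliable fun p : {p : ℕ // p.Prime ∧ p ≠ q} => 1 - towerWeight q p := by
    simpa only [sub_eq_add_neg] using Real.multipliable_one_add_of_summable hsum
  have hunif : TendstoUniformly
      (fun (T : Finset {p : ℕ // p.Prime ∧ p ≠ q}) N => setRatio (towerAvoid q T) N)
      (setRatio {n | ¬ TowerMem q n}) atTop := by
    rw [Metric.tendstoUniformly_iff]
    intro ε hε
    filter_upwards [(tendsto_order.1 (tendsto_tsum_compl_atTop_zero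
      fun p : {p : ℕ // p.Prime ∧ p ≠ q} => 1 / ((p : ℕ) : ℝ) ^ 2)).2 ε hε] with T hT N
    rw [dist_comm, Real.dist_eq, abs_of_nonneg (sub_nonneg.2 (setRatio_not_towerMem_le hq T N))]
    exact (setRatio_towerAvoid_sub_le hq T N).trans_lt hT
  exact (hunif.tendstoUniformlyOnFilter.mono_right le_top).tendsto_of_eventually_tendsto
    (Eventually.of_forall fun T => tendsto_setRatio_towerAvoid hq T)
    (hmul.hasProd.const_mul _)

theorem tower_density_exists_eq_prod (q : ℕ) (hq : q.Prime) :
    Tendsto (towerRatio q) atTop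
      (𝓝 (1 - (1 - 1 / (q : ℝ)) *
        ∏' p : {p : ℕ // p.Prime ∧ p ≠ q},
          (1 - (1 - 1 / ((p : ℕ) : ℝ)) *
            ∑' m : {m : ℕ // TowerMem q m}, 1 / ((p : ℕ) : ℝ) ^ (m : ℕ)))) := by
  refine (tendsto_setRatio_univ.sub (tendsto_setRatio_not_towerMem hq)).congr fun N => ?_
  rw [← setRatio_diff (Set.subset_univ _)]
  exact setRatio_congr_of_pos (t := {n | TowerMem q n}) (fun n _ => by simp) N
end

section
/- Let q be a prime and suppose that for each prime p ≠ q a set S(p) ⊆ M(q) is given. Then d(q) ≥ 1 - (1 - 1/q) · ∏_{p prime, p ≠ q} [1 - (1 - 1/p) · Σ_{s ∈ S(p)} 1/p^s]. -/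
open Filter Topology

/-- A periodic predicate on `ℕ` is counted over several periods by multiplication. -/
theorem count_mul_of_periodic (A : ℕ → Prop) [DecidablePred A] {m : ℕ}
    (hA : Function.Periodic A m) (k : ℕ) : Nat.count A (k * m) = k * Nat.count A m := by
  induction k with
  | zero => simp
  | succ k ih =>
    have h : (fun i => A (k * m + i)) = A := by
      funext i
      rw [add_comm]
      exact hA.nat_mul k i
    rw [add_mul, one_mul, Nat.count_add, ih, add_mul, one_mul]
    simp only [funext_iff] at h
    simp only [h]

/-- Predicates with coprime periods are independent; one inequality. -/
theorem count_and_le_mul (A B : ℕ → Prop) [DecidablePred A] [DecidablePred B] {m k : ℕ}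
    (hm : 0 < m) (hk : 0 < k) (hA : Function.Periodic A m) (hB : Function.Periodic B k)
    (hmk : m.Coprime k) :
    Nat.count (fun n => A n ∧ B n) (m * k) ≤ Nat.count A m * Nat.count B k := by
  simp only [Nat.count_eq_card_filter_range]
  rw [← Finset.card_product]
  refine Finset.card_le_card_of_injOn (fun n => (n % m, n % k)) ?_ ?_
  · intro n hn
    simp only [Finset.coe_filter, Finset.mem_range, Set.mem_ofPred_eq] at hn
    simp only [Finset.coe_product, Set.mem_prod, Finset.coe_filter, Finset.mem_range,
      Set.mem_ofPred_eq, hA.map_mod_nat, hB.map_mod_nat]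
    exact ⟨⟨Nat.mod_lt _ hm, hn.2.1⟩, Nat.mod_lt _ hk, hn.2.2⟩
  · intro a ha b hb hab
    simp only [Finset.coe_filter, Finset.mem_range, Set.mem_ofPred_eq] at ha hb
    simp only [Prod.mk.injEq] at hab
    have h : a ≡ b [MOD m * k] := (Nat.modEq_and_modEq_iff_modEq_mul hmk).1 hab
    exact h.eq_of_lt_of_lt ha.1 hb.1

theorem count_dvd_mul (a b : ℕ) (ha : 0 < a) : Nat.count (fun n => a ∣ n) (b * a) = b := by
  have hper : Function.Periodic (fun n => a ∣ n) a := fun n => by simp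
  rw [count_mul_of_periodic _ hper]
  have h : Nat.count (fun n => a ∣ n) a = 1 := by
    rw [Nat.count_eq_card_filter_range, Finset.card_eq_one]
    refine ⟨0, ?_⟩
    ext n
    simp only [Finset.mem_filter, Finset.mem_range, Finset.mem_singleton]
    constructor
    · rintro ⟨h1, h2⟩
      exact Nat.eq_zero_of_dvd_of_lt h2 h1
    · rintro rfl
      exact ⟨ha, dvd_zero _⟩
  rw [h, mul_one]

theorem card_filter_exact_pow (p s K : ℕ) (hp : p.Prime) (hs : s < K) :
    (((Finset.range (p ^ K)).filter fun n => p ^ s ∣ n ∧ ¬ p ^ (s + 1) ∣ n).card : ℝ) =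
      (p : ℝ) ^ K * ((1 - 1 / (p : ℝ)) * (1 / (p : ℝ) ^ s)) := by
  have hp0 : (p : ℝ) ≠ 0 := by exact_mod_cast hp.ne_zero
  obtain ⟨t, rfl⟩ := Nat.exists_eq_add_of_lt hs
  have h1 : ((Finset.range (p ^ (s + t + 1))).filter fun n => p ^ s ∣ n).card = p ^ (t + 1) := by
    rw [← Nat.count_eq_card_filter_range, show p ^ (s + t + 1) = p ^ (t + 1) * p ^ s by ring]
    exact count_dvd_mul _ _ (pow_pos hp.pos _)
  have h2 : ((Finset.range (p ^ (s + t + 1))).filter fun n => p ^ (s + 1) ∣ n).card = p ^ t := by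
    rw [← Nat.count_eq_card_filter_range, show p ^ (s + t + 1) = p ^ t * p ^ (s + 1) by ring]
    exact count_dvd_mul _ _ (pow_pos hp.pos _)
  have h3 : ((Finset.range (p ^ (s + t + 1))).filter fun n => p ^ s ∣ n ∧ ¬ p ^ (s + 1) ∣ n).card
      + p ^ t = p ^ (t + 1) := by
    rw [← h1, ← h2, ← Finset.card_filter_add_card_filter_not (s := (Finset.range
      (p ^ (s + t + 1))).filter fun n => p ^ s ∣ n) (fun n => ¬ p ^ (s + 1) ∣ n),
      Finset.filter_filter, Finset.filter_filter]
    congr 2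
    ext n
    simp only [Finset.mem_filter, not_not]
    exact and_congr_right fun _ =>
      ⟨fun h => ⟨(pow_dvd_pow p (Nat.le_succ s)).trans h, h⟩, fun h => h.2⟩
  have h4 := congrArg (Nat.cast (R := ℝ)) h3
  push_cast at h4
  rw [eq_sub_of_add_eq h4]
  field_simp
  ring

/-- The number of residues modulo `p ^ K` whose exact power of `p` avoids the finite set `T`. -/
theorem count_avoid_exact_pow (p K : ℕ) (hp : p.Prime) (T : Finset ℕ) (hT : ∀ s ∈ T, s < K) :
    (Nat.count (fun n => ∀ s ∈ T, ¬ (p ^ s ∣ n ∧ ¬ p ^ (s + 1) ∣ n)) (p ^ K) : ℝ) =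
      (p : ℝ) ^ K * (1 - (1 - 1 / (p : ℝ)) * ∑ s ∈ T, 1 / (p : ℝ) ^ s) := by
  have hU : (Finset.range (p ^ K)).filter
      (fun n => ¬ ∀ s ∈ T, ¬ (p ^ s ∣ n ∧ ¬ p ^ (s + 1) ∣ n)) =
      T.biUnion fun s => (Finset.range (p ^ K)).filter
        fun n => p ^ s ∣ n ∧ ¬ p ^ (s + 1) ∣ n := by
    ext n
    simp only [Finset.mem_filter, Finset.mem_biUnion]
    push Not
    tauto
  have hcard := Finset.card_filter_add_card_filter_not (s := Finset.range (p ^ K))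
    (fun n => ∀ s ∈ T, ¬ (p ^ s ∣ n ∧ ¬ p ^ (s + 1) ∣ n))
  have aux : ∀ {a b n : ℕ}, a < b → p ^ b ∣ n → p ^ (a + 1) ∣ n :=
    fun hab h => (pow_dvd_pow p hab).trans h
  rw [hU, Finset.card_biUnion, Finset.card_range] at hcard
  · have h := congrArg (Nat.cast (R := ℝ)) hcard
    push_cast at h
    rw [Nat.count_eq_card_filter_range, eq_sub_of_add_eq h,
      Finset.sum_congr rfl fun s hs => card_filter_exact_pow p s K hp (hT s hs),
      ← Finset.mul_sum, ← Finset.mul_sum]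
    ring
  · intro a _ b _ hab
    simp only [Function.onFun, Finset.disjoint_left]
    intro n ha hb
    simp only [Finset.mem_filter] at ha hb
    rcases lt_or_gt_of_ne hab with h | h
    · exact ha.2.2 (aux h hb.2.1)
    · exact hb.2.2 (aux h ha.2.1)

open Classical in
theorem exists_period_avoid (q : ℕ) (hq : q.Prime) (T : ℕ → Finset ℕ)
    (F : Finset {p : ℕ // p.Prime ∧ p ≠ q}) :
    ∃ m : ℕ, 0 < m ∧ (∀ r : {p : ℕ // p.Prime ∧ p ≠ q}, r ∉ F → m.Coprime r) ∧
      Function.Periodic (fun n => ¬ q ∣ n ∧ ∀ p ∈ F, ∀ s ∈ T p,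
        ¬ ((p : ℕ) ^ s ∣ n ∧ ¬ (p : ℕ) ^ (s + 1) ∣ n)) m ∧
      (Nat.count (fun n => ¬ q ∣ n ∧ ∀ p ∈ F, ∀ s ∈ T p,
        ¬ ((p : ℕ) ^ s ∣ n ∧ ¬ (p : ℕ) ^ (s + 1) ∣ n)) m : ℝ) ≤
      m * ((1 - 1 / (q : ℝ)) * ∏ p ∈ F,
        (1 - (1 - 1 / ((p : ℕ) : ℝ)) * ∑ s ∈ T p, 1 / ((p : ℕ) : ℝ) ^ s)) := by
  induction F using Finset.induction_on with
  | empty =>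
    refine ⟨q, hq.pos, fun r _ => (Nat.coprime_primes hq r.2.1).2 r.2.2.symm, ?_, ?_⟩
    · intro n
      simp
    · have h := count_avoid_exact_pow q 1 hq {0} (by simp)
      have hq0 : (q : ℝ) ≠ 0 := by exact_mod_cast hq.ne_zero
      have h' := Finset.card_filter_add_card_filter_not (s := Finset.range q) (fun n => q ∣ n)
      have h1 : ((Finset.range q).filter fun n => q ∣ n).card = 1 := by
        rw [← Nat.count_eq_card_filter_range]
        simpa using count_dvd_mul q 1 hq.pos
      rw [h1, Finset.card_range] at h'
      have h2 := congrArg (Nat.cast (R := ℝ)) h'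
      push_cast at h2
      simp only [Finset.notMem_empty, false_implies, implies_true, and_true, Finset.prod_empty,
        Nat.count_eq_card_filter_range, mul_one]
      rw [eq_sub_of_add_eq' h2]
      field_simp
      rfl
  | insert r F hr ih =>
    obtain ⟨m, hm, hcop, hper, hcount⟩ := ih
    set K := (T r).sup id + 1 with hK
    have hTK : ∀ s ∈ T r, s < K := fun s hs => Nat.lt_succ_of_le (Finset.le_sup (f := id) hs)
    have hc := count_avoid_exact_pow r K r.2.1 (T r) hTK
    have hperr : Function.Periodic (fun n => ∀ s ∈ T r,
        ¬ ((r : ℕ) ^ s ∣ n ∧ ¬ (r : ℕ) ^ (s + 1) ∣ n)) ((r : ℕ) ^ K) := by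
      intro n
      refine propext (forall₂_congr fun s hs => ?_)
      rw [Nat.dvd_add_left (pow_dvd_pow _ (hTK s hs).le),
        Nat.dvd_add_left (pow_dvd_pow _ (Nat.succ_le_of_lt (hTK s hs)))]
    have hpred : (fun n => ¬ q ∣ n ∧ ∀ p ∈ insert r F, ∀ s ∈ T p,
        ¬ ((p : ℕ) ^ s ∣ n ∧ ¬ (p : ℕ) ^ (s + 1) ∣ n)) =
        fun n => (¬ q ∣ n ∧ ∀ p ∈ F, ∀ s ∈ T p,
          ¬ ((p : ℕ) ^ s ∣ n ∧ ¬ (p : ℕ) ^ (s + 1) ∣ n)) ∧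
          ∀ s ∈ T r, ¬ ((r : ℕ) ^ s ∣ n ∧ ¬ (r : ℕ) ^ (s + 1) ∣ n) := by
      funext n
      simp only [Finset.forall_mem_insert]
      exact propext (by tauto)
    refine ⟨m * (r : ℕ) ^ K, Nat.mul_pos hm (pow_pos r.2.1.pos _), ?_, ?_, ?_⟩
    · intro t ht
      rw [Finset.mem_insert, not_or] at ht
      exact Nat.Coprime.mul_left (hcop t ht.2) (Nat.Coprime.pow_left _
        ((Nat.coprime_primes r.2.1 t.2.1).2 fun h => ht.1 (Subtype.ext h.symm)))
    · rw [hpred]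
      intro n
      have h1 := hper.nat_mul ((r : ℕ) ^ K) n
      have h2 := hperr.nat_mul m n
      rw [Nat.cast_id, mul_comm] at h1
      rw [Nat.cast_id] at h2
      exact congrArg₂ And h1 h2
    · have hle := count_and_le_mul _ _ hm (pow_pos r.2.1.pos K) hper hperr
        ((hcop r hr).pow_right K)
      simp only [← hpred] at hle
      have hle' := (Nat.cast_le (α := ℝ)).2 hle
      rw [Nat.cast_mul] at hle'
      rw [Finset.prod_insert hr]
      have hmul := mul_le_mul_of_nonneg_right hcount (hc ▸ Nat.cast_nonneg _ :
        (0 : ℝ) ≤ ((r : ℕ) : ℝ) ^ K * (1 - (1 - 1 / ((r : ℕ) : ℝ)) *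
          ∑ s ∈ T r, 1 / ((r : ℕ) : ℝ) ^ s))
      rw [← hc] at hmul
      refine (hle'.trans hmul).trans (le_of_eq ?_)
      rw [hc]
      push_cast
      ring

/-- An integer with an exact prime power exponent in `M(q)` lies in `M(q)`. -/
theorem TowerMem.of_exact_pow {q n p s : ℕ} (hn : 0 < n) (hp : p.Prime) (hs : TowerMem q s)
    (h1 : p ^ s ∣ n) (h2 : ¬ p ^ (s + 1) ∣ n) : TowerMem q n := by
  have hpn : p ∣ n := (dvd_pow_self p (by have := hs.two_le; omega)).trans h1
  have hf : n.factorization p = s := by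
    rw [hp.pow_dvd_iff_le_factorization hn.ne'] at h1 h2
    omega
  exact .step n p (hp.two_le.trans (Nat.le_of_dvd hn hpn)) hp hpn (hf ▸ hs)

theorem one_sub_density_le_of_finset (q : ℕ) (hq : q.Prime) (T : ℕ → Finset ℕ)
    (hT : ∀ p : ℕ, p.Prime → p ≠ q → ∀ s ∈ T p, TowerMem q s)
    (d : ℝ) (hd : Tendsto (towerRatio q) atTop (𝓝 d)) (F : Finset {p : ℕ // p.Prime ∧ p ≠ q}) :
    1 - d ≤ (1 - 1 / (q : ℝ)) * ∏ p ∈ F,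
      (1 - (1 - 1 / ((p : ℕ) : ℝ)) * ∑ s ∈ T p, 1 / ((p : ℕ) : ℝ) ^ s) := by
  classical
  obtain ⟨m, hm, -, hper, hcount⟩ := exists_period_avoid q hq T F
  have hsub : Tendsto (fun k : ℕ => (k + 1) * m) atTop atTop :=
    (tendsto_add_atTop_nat 1).atTop_mul_const' hm
  refine le_of_tendsto ((hd.comp hsub).const_sub 1) (Eventually.of_forall fun k => ?_)
  simp only [Function.comp_apply, towerRatio]
  set P : ℕ → Prop := fun n => ¬ q ∣ n ∧ ∀ p ∈ F, ∀ s ∈ T p,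
        ¬ ((p : ℕ) ^ s ∣ n ∧ ¬ (p : ℕ) ^ (s + 1) ∣ n) with hP
  set N := (k + 1) * m with hN
  have hN0 : 0 < N := Nat.mul_pos k.succ_pos hm
  have hNR : (0 : ℝ) < N := by exact_mod_cast hN0
  have hperN : Function.Periodic P N := by
    simpa using hper.nat_mul (k + 1)
  have hcN : ((Finset.Icc 1 N).filter P).card = (k + 1) * Nat.count P m := by
    rw [← count_mul_of_periodic P hper, ← hN, ← Nat.filter_Ico_card_eq_of_periodic 1 N P hperN,
      add_comm 1 N]
    rfl
  have hsplit := Finset.card_filter_add_card_filter_not (s := Finset.Icc 1 N)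
    (fun n => TowerMem q n)
  have hle : ((Finset.Icc 1 N).filter fun n => ¬ TowerMem q n).card ≤
      ((Finset.Icc 1 N).filter P).card := by
    refine Finset.card_le_card fun n hn => ?_
    rw [Finset.mem_filter] at hn ⊢
    have hn1 : 0 < n := (Finset.mem_Icc.1 hn.1).1
    refine ⟨hn.1, fun h => hn.2 (.base n (hq.two_le.trans (Nat.le_of_dvd hn1 h)) h), ?_⟩
    intro p _ s hs h
    exact hn.2 (.of_exact_pow hn1 p.2.1 (hT p p.2.1 p.2.2 s hs) h.1 h.2)
  rw [Nat.card_Icc, Nat.add_sub_cancel] at hsplit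
  rw [hcN] at hle
  have h1 := congrArg (Nat.cast (R := ℝ)) hsplit
  have h2 := (Nat.cast_le (α := ℝ)).2 hle
  have h3 : ((N : ℕ) : ℝ) = (k + 1) * m := by rw [hN]; push_cast; ring
  push_cast at h1 h2
  rw [one_sub_div hNR.ne', div_le_iff₀ hNR]
  have h4 := mul_le_mul_of_nonneg_left hcount (by positivity : (0 : ℝ) ≤ (k : ℝ) + 1)
  calc _ ≤ _ := by linarith
    _ ≤ _ := h4
    _ = _ := by rw [h3]; ring

theorem one_sub_density_le_of_tsum (q : ℕ) (hq : q.Prime)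
    (S : ℕ → Set ℕ) (hS : ∀ p : ℕ, p.Prime → p ≠ q → S p ⊆ {m | TowerMem q m})
    (d : ℝ) (hd : Tendsto (towerRatio q) atTop (𝓝 d)) (F : Finset {p : ℕ // p.Prime ∧ p ≠ q}) :
    1 - d ≤ (1 - 1 / (q : ℝ)) * ∏ p ∈ F,
      (1 - (1 - 1 / ((p : ℕ) : ℝ)) * ∑' s : S (p : ℕ), 1 / ((p : ℕ) : ℝ) ^ (s : ℕ)) := by
  classical
  have hlim : ∀ p ∈ F, Tendsto (fun K : ℕ => 1 - (1 - 1 / ((p : ℕ) : ℝ)) *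
      ∑ s ∈ (Finset.range K).filter (· ∈ S p), 1 / ((p : ℕ) : ℝ) ^ s) atTop
      (𝓝 (1 - (1 - 1 / ((p : ℕ) : ℝ)) *
        ∑' s : S (p : ℕ), 1 / ((p : ℕ) : ℝ) ^ (s : ℕ))) := by
    intro p _
    have hp1 : (1 : ℝ) < ((p : ℕ) : ℝ) := by exact_mod_cast p.2.1.one_lt
    have hsum : Summable fun s : ℕ => 1 / ((p : ℕ) : ℝ) ^ s := by
      simpa only [one_div_pow] using summable_geometric_of_lt_one (by positivity)
        ((div_lt_one (by positivity)).2 hp1)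
    have h := (hsum.indicator (S p)).hasSum.tendsto_sum_nat
    rw [← tsum_subtype (S (p : ℕ)) fun s : ℕ => 1 / ((p : ℕ) : ℝ) ^ s] at h
    refine (Tendsto.const_mul _ ?_).const_sub _
    refine h.congr fun K => ?_
    rw [Finset.sum_filter]
    exact Finset.sum_congr rfl fun s _ => Set.indicator_apply _ _ _
  refine ge_of_tendsto' ((tendsto_finsetProd F hlim).const_mul (1 - 1 / (q : ℝ))) fun K => ?_
  exact one_sub_density_le_of_finset q hq (fun p => (Finset.range K).filter (· ∈ S p))
    (fun p hp hpq s hs => hS p hp hpq (Finset.mem_filter.1 hs).2) d hd F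

theorem tower_density_lower_bound_subsets (q : ℕ) (hq : q.Prime)
    (S : ℕ → Set ℕ) (hS : ∀ p : ℕ, p.Prime → p ≠ q → S p ⊆ {m | TowerMem q m})
    (d : ℝ) (hd : Tendsto (towerRatio q) atTop (𝓝 d)) :
    d ≥ 1 - (1 - 1 / (q : ℝ)) *
      ∏' p : {p : ℕ // p.Prime ∧ p ≠ q},
        (1 - (1 - 1 / ((p : ℕ) : ℝ)) *
          ∑' s : S (p : ℕ), 1 / ((p : ℕ) : ℝ) ^ (s : ℕ)) := by
  have key := one_sub_density_le_of_tsum q hq S hS d hd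
  by_cases hm : Multipliable fun p : {p : ℕ // p.Prime ∧ p ≠ q} =>
      (1 - (1 - 1 / ((p : ℕ) : ℝ)) * ∑' s : S (p : ℕ), 1 / ((p : ℕ) : ℝ) ^ (s : ℕ))
  · have h : Tendsto _ atTop _ := hm.hasProd
    linarith [ge_of_tendsto' (h.const_mul (1 - 1 / (q : ℝ))) key]
  · rw [tprod_eq_one_of_not_multipliable hm]
    have h := key ∅
    rw [Finset.prod_empty] at h
    linarith
end

section
/- Let q be a prime and suppose that for each prime p ≠ q a set T(p) ⊇ M(q) of positive integers is given. Then d(q) ≤ 1 - (1 - 1/q) · ∏_{p prime, p ≠ q} [1 - (1 - 1/p) · Σ_{t ∈ T(p)} 1/p^t]. -/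
open Filter Topology

open Classical in
/-- The number of elements of `A` in `{1, …, N}`. -/
noncomputable def countUpTo (A : Set ℕ) (N : ℕ) : ℕ :=
  ((Finset.Icc 1 N).filter fun n => n ∈ A).card

theorem countUpTo_zero (A : Set ℕ) : countUpTo A 0 = 0 := by
  simp [countUpTo]

theorem countUpTo_le (A : Set ℕ) (N : ℕ) : countUpTo A N ≤ N := by
  classical
  exact (Finset.card_filter_le _ _).trans_eq (by simp)

theorem countUpTo_mono (A : Set ℕ) : Monotone (countUpTo A) := by
  classical
  exact fun _ _ h =>
    Finset.card_le_card (Finset.filter_subset_filter _ (Finset.Icc_subset_Icc_right h))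

/-- If membership in `A` is insensitive to multiplication by `k`, then `A` counted up to `N / k`
counts the multiples of `k` in `A` up to `N`. -/
theorem countUpTo_div (A : Set ℕ) {k : ℕ} (hk : 0 < k)
    (hA : ∀ m, 0 < m → (k * m ∈ A ↔ m ∈ A)) (N : ℕ) :
    countUpTo A (N / k) = countUpTo {n | k ∣ n ∧ n ∈ A} N := by
  classical
  refine Finset.card_bij (fun m _ => k * m) ?_ ?_ ?_
  · intro m hm
    simp only [Finset.mem_filter, Finset.mem_Icc, Set.mem_ofPred_eq] at hm ⊢
    refine ⟨⟨Nat.mul_pos hk hm.1.1, ?_⟩, dvd_mul_right _ _, (hA m hm.1.1).2 hm.2⟩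
    rw [mul_comm]
    exact (Nat.le_div_iff_mul_le hk).1 hm.1.2
  · intro a _ b _ h
    exact Nat.eq_of_mul_eq_mul_left hk h
  · intro n hn
    simp only [Finset.mem_filter, Finset.mem_Icc, Set.mem_ofPred_eq] at hn
    obtain ⟨⟨hn1, hnN⟩, ⟨m, rfl⟩, hnA⟩ := hn
    have hm : 0 < m := Nat.pos_of_mul_pos_left hn1
    refine ⟨m, ?_, rfl⟩
    simp only [Finset.mem_filter, Finset.mem_Icc]
    refine ⟨⟨hm, (Nat.le_div_iff_mul_le hk).2 ?_⟩, (hA m hm).1 hnA⟩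
    rwa [mul_comm]

theorem tendsto_countUpTo_div {A : Set ℕ} {δ : ℝ}
    (hA : Tendsto (fun N : ℕ => (countUpTo A N : ℝ) / N) atTop (𝓝 δ)) {k : ℕ} (hk : 0 < k) :
    Tendsto (fun N : ℕ => (countUpTo A (N / k) : ℝ) / N) atTop (𝓝 (δ * (1 / k))) := by
  have h1 := hA.comp (Nat.tendsto_div_const_atTop hk.ne')
  have h2 : Tendsto (fun N : ℕ => ((N / k : ℕ) : ℝ) / N) atTop (𝓝 (1 / (k : ℝ))) := by
    have := (tendsto_nat_floor_mul_div_atTop (R := ℝ) (a := 1 / (k : ℝ))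
      (by positivity)).comp tendsto_natCast_atTop_atTop
    refine this.congr fun N => ?_
    simp only [Function.comp]
    rw [one_div_mul_eq_div, Nat.floor_div_eq_div]
  refine (h1.mul h2).congr fun N => ?_
  simp only [Function.comp]
  rcases Nat.eq_zero_or_pos (N / k) with h | h
  · simp [h, countUpTo_zero]
  · have : ((N / k : ℕ) : ℝ) ≠ 0 := by positivity
    rw [div_mul_div_cancel₀ this]

/-- The integers whose `p`-adic valuation lies in `C p` for every `p ∈ S`. -/
def factorizationMem (C : ℕ → Set ℕ) (S : Finset ℕ) : Set ℕ :=
  {n | ∀ p ∈ S, n.factorization p ∈ C p}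

theorem pow_mul_mem_factorizationMem {C : ℕ → Set ℕ} {S : Finset ℕ} {p : ℕ} (hp : p.Prime)
    (hpS : p ∉ S) (t : ℕ) {m : ℕ} (hm : 0 < m) :
    p ^ t * m ∈ factorizationMem C S ↔ m ∈ factorizationMem C S := by
  refine forall₂_congr fun r hr => ?_
  have hne : r ≠ p := fun h => hpS (h ▸ hr)
  rw [Nat.factorization_mul (pow_ne_zero _ hp.ne_zero) hm.ne', hp.factorization_pow]
  simp [hne.symm]

theorem countUpTo_factorization_eq {C : ℕ → Set ℕ} {S : Finset ℕ} {p : ℕ} (hp : p.Prime)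
    (hpS : p ∉ S) (t N : ℕ) :
    (countUpTo {n | n.factorization p = t ∧ n ∈ factorizationMem C S} N : ℝ) =
      countUpTo (factorizationMem C S) (N / p ^ t) -
        countUpTo (factorizationMem C S) (N / p ^ (t + 1)) := by
  classical
  rw [countUpTo_div _ (pow_pos hp.pos t) fun m => pow_mul_mem_factorizationMem hp hpS t,
    countUpTo_div _ (pow_pos hp.pos (t + 1)) fun m => pow_mul_mem_factorizationMem hp hpS (t + 1),
    eq_sub_iff_add_eq]
  norm_cast
  rw [countUpTo, countUpTo, countUpTo, ← Finset.card_union_of_disjoint]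
  · congr 1
    ext n
    simp only [Finset.mem_union, Finset.mem_filter, Finset.mem_Icc, Set.mem_ofPred_eq]
    by_cases hn : 1 ≤ n
    · rw [hp.pow_dvd_iff_le_factorization (by lia), hp.pow_dvd_iff_le_factorization (by lia)]
      grind
    · simp [hn]
  · rw [Finset.disjoint_left]
    intro n
    simp only [Finset.mem_filter, Finset.mem_Icc, Set.mem_ofPred_eq]
    rintro ⟨⟨hn, -⟩, h, -⟩ ⟨-, h', -⟩
    rw [hp.pow_dvd_iff_le_factorization (by lia)] at h'
    lia

theorem countUpTo_factorizationMem_insert {C : ℕ → Set ℕ} {S : Finset ℕ} {p : ℕ} (hp : p.Prime)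
    (hpS : p ∉ S) (N : ℕ) :
    (countUpTo (factorizationMem C (insert p S)) N : ℝ) =
      ∑' t, (C p).indicator (fun t => (countUpTo (factorizationMem C S) (N / p ^ t) : ℝ) -
        countUpTo (factorizationMem C S) (N / p ^ (t + 1))) t := by
  classical
  rw [tsum_eq_sum (s := Finset.range (N + 1))]
  · rw [countUpTo, Finset.card_eq_sum_card_fiberwise (f := fun n => n.factorization p)
      (t := Finset.range (N + 1)), Nat.cast_sum]
    · refine Finset.sum_congr rfl fun t _ => ?_
      by_cases ht : t ∈ C p
      · rw [Set.indicator_of_mem ht, ← countUpTo_factorization_eq hp hpS, countUpTo,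
          Finset.filter_filter]
        congr 2
        ext n
        simp only [Finset.mem_filter, Set.mem_ofPred_eq, factorizationMem, Finset.forall_mem_insert]
        grind
      · rw [Set.indicator_of_notMem ht, Nat.cast_eq_zero, Finset.card_eq_zero,
          Finset.filter_eq_empty_iff]
        intro n hn h
        simp only [Finset.mem_filter, factorizationMem, Set.mem_ofPred_eq,
          Finset.forall_mem_insert] at hn
        exact ht (h ▸ hn.2.1)
    · intro n hn
      simp only [Finset.coe_filter, Finset.mem_Icc, Set.mem_ofPred_eq] at hn
      have := Nat.factorization_lt p (n := n) (by lia)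
      simp only [Finset.coe_range, Set.mem_Iio]
      lia
  · intro t ht
    simp only [Finset.mem_range, not_lt] at ht
    have h1 : N < p ^ t := lt_of_lt_of_le (by lia) (Nat.lt_pow_self hp.one_lt).le
    have h2 : N < p ^ (t + 1) := h1.trans_le (Nat.pow_le_pow_right hp.pos (Nat.le_succ t))
    refine Set.indicator_apply_eq_zero.2 fun _ => ?_
    rw [Nat.div_eq_of_lt h1, Nat.div_eq_of_lt h2, sub_self]

/-- The density of the integers whose `p`-adic valuation lies in `C`. -/
noncomputable def localDensity (C : Set ℕ) (p : ℕ) : ℝ :=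
  (1 - 1 / (p : ℝ)) * ∑' t, C.indicator (fun t => 1 / (p : ℝ) ^ t) t

theorem summable_one_div_pow {p : ℕ} (hp : p.Prime) :
    Summable fun t : ℕ => 1 / (p : ℝ) ^ t := by
  simpa only [one_div_pow] using summable_geometric_of_lt_one (r := 1 / (p : ℝ)) (by positivity)
    (by rw [div_lt_one (by exact_mod_cast hp.pos)]; exact_mod_cast hp.one_lt)

theorem one_sub_one_div_nonneg {p : ℕ} (hp : p.Prime) : 0 ≤ 1 - 1 / (p : ℝ) := by
  rw [sub_nonneg, div_le_one (by exact_mod_cast hp.pos)]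
  exact_mod_cast hp.one_lt.le

theorem one_sub_mul_tsum_one_div_pow {p : ℕ} (hp : p.Prime) :
    (1 - 1 / (p : ℝ)) * ∑' t : ℕ, 1 / (p : ℝ) ^ t = 1 := by
  have h : 1 / (p : ℝ) < 1 := by
    rw [div_lt_one (by exact_mod_cast hp.pos)]; exact_mod_cast hp.one_lt
  simp only [← one_div_pow]
  rw [tsum_geometric_of_lt_one (by positivity) h]
  exact mul_inv_cancel₀ (by linarith)

theorem tendsto_countUpTo_factorizationMem (C : ℕ → Set ℕ) (S : Finset ℕ)
    (hS : ∀ p ∈ S, p.Prime) :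
    Tendsto (fun N : ℕ => (countUpTo (factorizationMem C S) N : ℝ) / N) atTop
      (𝓝 (∏ p ∈ S, localDensity (C p) p)) := by
  classical
  induction S using Finset.induction_on with
  | empty =>
    refine tendsto_const_nhds.congr' ?_
    filter_upwards [eventually_gt_atTop 0] with N hN
    have : (N : ℝ) ≠ 0 := by positivity
    simp [countUpTo, factorizationMem, this]
  | insert p S hpS ih =>
    have hp := hS p (Finset.mem_insert_self p S)
    have ih := ih fun r hr => hS r (Finset.mem_insert_of_mem hr)
    set δ := ∏ r ∈ S, localDensity (C r) r
    set A := factorizationMem C S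
    have hlim : ∏ r ∈ insert p S, localDensity (C r) r =
        ∑' t, (C p).indicator
          (fun t => δ * (1 / (p : ℝ) ^ t) - δ * (1 / (p : ℝ) ^ (t + 1))) t := by
      rw [Finset.prod_insert hpS, localDensity, mul_right_comm, ← tsum_mul_left]
      refine tsum_congr fun t => ?_
      by_cases ht : t ∈ C p
      · simp only [Set.indicator_of_mem ht]
        rw [pow_succ]
        have : (p : ℝ) ≠ 0 := by exact_mod_cast hp.ne_zero
        field_simp
        ring
      · simp [Set.indicator_of_notMem ht]
    rw [hlim]
    simp only [countUpTo_factorizationMem_insert hp hpS, ← tsum_div_const]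
    refine tendsto_tsum_of_dominated_convergence (bound := fun t => 1 / (p : ℝ) ^ t)
      (summable_one_div_pow hp) (fun t => ?_) (Eventually.of_forall fun N t => ?_)
    · by_cases ht : t ∈ C p
      · simp only [Set.indicator_of_mem ht, sub_div]
        have h := fun k => tendsto_countUpTo_div ih (pow_pos hp.pos k)
        simp only [Nat.cast_pow] at h
        exact (h t).sub (h (t + 1))
      · simp [Set.indicator_of_notMem ht]
    · by_cases ht : t ∈ C p
      · rw [Set.indicator_of_mem ht]
        have hmono : (countUpTo A (N / p ^ (t + 1)) : ℝ) ≤ countUpTo A (N / p ^ t) := by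
          exact_mod_cast countUpTo_mono A
            (Nat.div_le_div_left (Nat.pow_le_pow_right hp.pos (Nat.le_succ t)) (pow_pos hp.pos t))
        have hle : (countUpTo A (N / p ^ t) : ℝ) ≤ N / (p : ℝ) ^ t := by
          refine le_trans (by exact_mod_cast countUpTo_le A _) (Nat.cast_div_le.trans ?_)
          rw [Nat.cast_pow]
        have hnn : (0 : ℝ) ≤ countUpTo A (N / p ^ (t + 1)) := by positivity
        rw [Real.norm_of_nonneg (div_nonneg (sub_nonneg.2 hmono) (by positivity))]
        refine div_le_of_le_mul₀ (by positivity) (by positivity) ?_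
        rw [one_div_mul_eq_div]
        linarith
      · rw [Set.indicator_of_notMem ht]
        simp

open Classical in
/-- The admissible `p`-adic valuations of an integer outside `M(q)`. -/
noncomputable def allowedExponents (q p : ℕ) : Set ℕ :=
  if p = q then {0} else {t | ¬ TowerMem q t}

theorem TowerMem.exists_sq_dvd {q n P : ℕ} (hq : q.Prime) (hqP : q ≤ P) (h : TowerMem q n)
    (hn : n ∈ factorizationMem (allowedExponents q) ((Finset.Icc 1 P).filter Nat.Prime)) :
    ∃ k, P < k ∧ k ≤ n ∧ k ^ 2 ∣ n := by
  have hn0 : n ≠ 0 := by have := h.two_le; lia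
  have hqn : ¬ q ∣ n := by
    intro hdvd
    have := hn q (by simp [hq, hqP, hq.one_le])
    simp only [allowedExponents, if_true, Set.mem_singleton_iff] at this
    exact (hq.factorization_pos_of_dvd hn0 hdvd).ne' this
  cases h with
  | base _ _ hdvd => exact absurd hdvd hqn
  | step _ p _ hp hdvd hexp =>
    refine ⟨p, ?_, Nat.le_of_dvd (by lia) hdvd,
      (hp.pow_dvd_iff_le_factorization hn0).2 hexp.two_le⟩
    by_contra! hpP
    have hpq : p ≠ q := fun h => hqn (h ▸ hdvd)
    have := hn p (by simp [hp, hpP, hp.one_le])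
    simp only [allowedExponents, if_neg hpq, Set.mem_ofPred_eq] at this
    exact this hexp

theorem towerRatio_le {q P N : ℕ} (hq : q.Prime) (hqP : q ≤ P) (hPN : P ≤ N) :
    towerRatio q N ≤ 1 - (countUpTo (factorizationMem (allowedExponents q)
      ((Finset.Icc 1 P).filter Nat.Prime)) N : ℝ) / N + 1 / P := by
  classical
  set A := factorizationMem (allowedExponents q) ((Finset.Icc 1 P).filter Nat.Prime)
  have hP : 0 < P := hq.pos.trans_le hqP
  have hN : (0 : ℝ) < N := by exact_mod_cast hP.trans_le hPN
  have hcard : ((Finset.Icc 1 N).filter fun n => TowerMem q n).card + countUpTo A N ≤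
      N + ∑ k ∈ Finset.Ioc P N, N / k ^ 2 := by
    have hsub : ((Finset.Icc 1 N).filter fun n => TowerMem q n) ⊆
        ((Finset.Icc 1 N).filter fun n => n ∉ A) ∪
          (Finset.Ioc P N).biUnion fun k => (Finset.Ioc 0 N).filter fun n => k ^ 2 ∣ n := by
      intro n hn
      simp only [Finset.mem_filter, Finset.mem_Icc, Finset.mem_union, Finset.mem_biUnion,
        Finset.mem_Ioc] at hn ⊢
      by_cases hnA : n ∈ A
      · obtain ⟨k, hPk, hkn, hk⟩ := hn.2.exists_sq_dvd hq hqP hnA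
        exact Or.inr ⟨k, ⟨hPk, hkn.trans hn.1.2⟩, hn.1, hk⟩
      · exact Or.inl ⟨hn.1, hnA⟩
    have h1 := (Finset.card_le_card hsub).trans (Finset.card_union_le _ _)
    have h2 := Finset.card_biUnion_le (s := Finset.Ioc P N)
      (t := fun k => (Finset.Ioc 0 N).filter fun n => k ^ 2 ∣ n)
    simp only [Nat.Ioc_filter_dvd_card_eq_div] at h2
    have h3 := Finset.card_filter_add_card_filter_not (s := Finset.Icc 1 N) (fun n => n ∈ A)
    rw [Nat.card_Icc] at h3
    unfold countUpTo
    lia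
  have hsum : ((∑ k ∈ Finset.Ioc P N, N / k ^ 2 : ℕ) : ℝ) ≤ N * (1 / P) := by
    push_cast
    calc ∑ k ∈ Finset.Ioc P N, ((N / k ^ 2 : ℕ) : ℝ)
        ≤ ∑ k ∈ Finset.Ioc P N, N * ((k : ℝ) ^ 2)⁻¹ := by
          refine Finset.sum_le_sum fun k _ => ?_
          rw [← div_eq_mul_inv]
          exact_mod_cast Nat.cast_div_le (α := ℝ) (m := N) (n := k ^ 2)
      _ ≤ N * (1 / P) := by
          rw [← Finset.mul_sum]
          refine mul_le_mul_of_nonneg_left ?_ hN.le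
          have := sum_Ioc_inv_sq_le_sub (α := ℝ) hP.ne' hPN
          have : (0 : ℝ) ≤ (N : ℝ)⁻¹ := by positivity
          rw [one_div]
          linarith
  have hcard' : (((Finset.Icc 1 N).filter fun n => TowerMem q n).card : ℝ) + countUpTo A N ≤
      N + (∑ k ∈ Finset.Ioc P N, N / k ^ 2 : ℕ) := by exact_mod_cast hcard
  have hle : towerRatio q N ≤ (N - countUpTo A N + N * (1 / P)) / N := by
    unfold towerRatio
    gcongr
    linarith
  refine hle.trans_eq ?_
  field_simp

theorem tprod_le_prod_of_le_one {ι : Type*} {f : ι → ℝ} (h0 : ∀ i, 0 ≤ f i) (h1 : ∀ i, f i ≤ 1)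
    (s : Finset ι) : ∏' i, f i ≤ ∏ i ∈ s, f i := by
  have hanti : Antitone fun s : Finset ι => ∏ i ∈ s, f i := 
    Finset.prod_anti_set_of_le_one h0 h1
  have hbdd : BddBelow (Set.range fun s : Finset ι => ∏ i ∈ s, f i) :=
    ⟨0, by rintro _ ⟨s, rfl⟩; exact Finset.prod_nonneg fun i _ => h0 i⟩
  have hprod : HasProd f (⨅ s : Finset ι, ∏ i ∈ s, f i) := tendsto_atTop_ciInf hanti hbdd
  rw [hprod.tprod_eq]
  exact ciInf_le hbdd s

theorem localDensity_singleton_zero (p : ℕ) : localDensity {0} p = 1 - 1 / (p : ℝ) := by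
  rw [localDensity, tsum_eq_single 0]
  · simp
  · intro t ht
    simp [ht]

theorem one_sub_mul_tsum_subtype_nonneg {p : ℕ} (hp : p.Prime) (B : Set ℕ) :
    0 ≤ 1 - (1 - 1 / (p : ℝ)) * ∑' t : B, 1 / (p : ℝ) ^ (t : ℕ) := by
  rw [sub_nonneg]
  refine le_trans ?_ (one_sub_mul_tsum_one_div_pow hp).le
  exact mul_le_mul_of_nonneg_left
    ((summable_one_div_pow hp).tsum_subtype_le _ B fun _ => by positivity)
    (one_sub_one_div_nonneg hp)

theorem one_sub_mul_tsum_subtype_le_localDensity {p : ℕ} (hp : p.Prime) {B C : Set ℕ}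
    (h : Bᶜ ⊆ C) :
    1 - (1 - 1 / (p : ℝ)) * ∑' t : B, 1 / (p : ℝ) ^ (t : ℕ) ≤ localDensity C p := by
  have hs := summable_one_div_pow hp
  rw [sub_le_iff_le_add, localDensity, ← mul_add]
  refine (one_sub_mul_tsum_one_div_pow hp).ge.trans ?_
  refine mul_le_mul_of_nonneg_left ?_ (one_sub_one_div_nonneg hp)
  rw [← hs.tsum_subtype_add_tsum_subtype_compl B, add_comm,
    tsum_subtype Bᶜ fun t : ℕ => 1 / (p : ℝ) ^ t]
  refine add_le_add ?_ le_rfl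
  exact (hs.indicator _).tsum_le_tsum
    (Set.indicator_le_indicator_of_subset h fun _ => by positivity) (hs.indicator _)

theorem tower_density_upper_bound_supersets (q : ℕ) (hq : q.Prime)
    (T : ℕ → Set ℕ)
    (hT : ∀ p : ℕ, p.Prime → p ≠ q → {m | TowerMem q m} ⊆ T p)
    (hTpos : ∀ p : ℕ, p.Prime → p ≠ q → T p ⊆ {m | 0 < m})
    (d : ℝ) (hd : Tendsto (towerRatio q) atTop (𝓝 d)) :
    d ≤ 1 - (1 - 1 / (q : ℝ)) *
      ∏' p : {p : ℕ // p.Prime ∧ p ≠ q},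
        (1 - (1 - 1 / ((p : ℕ) : ℝ)) *
          ∑' t : T (p : ℕ), 1 / ((p : ℕ) : ℝ) ^ (t : ℕ)) := by
  classical
  set f : ℕ → ℝ := fun p => 1 - (1 - 1 / (p : ℝ)) * ∑' t : T p, 1 / (p : ℝ) ^ (t : ℕ)
  set R := ∏' p : {p : ℕ // p.Prime ∧ p ≠ q}, f p
  have hbound : ∀ P : ℕ, q ≤ P → d ≤ 1 - (1 - 1 / (q : ℝ)) * R + 1 / P := by
    intro P hqP
    set S := (Finset.Icc 1 P).filter Nat.Prime
    have hS : ∀ p ∈ S, p.Prime := fun p hp => (Finset.mem_filter.1 hp).2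
    have hqS : q ∈ S := by simp [S, hq, hqP, hq.one_le]
    have hlim := tendsto_countUpTo_factorizationMem (allowedExponents q) S hS
    have hd' := le_of_tendsto_of_tendsto hd ((hlim.const_sub 1).add_const (1 / (P : ℝ)))
      ((eventually_ge_atTop P).mono fun N hN => towerRatio_le hq hqP hN)
    have hprod : R ≤ ∏ p ∈ S.erase q, localDensity (allowedExponents q p) p := by
      have hmem : ∀ p ∈ S.erase q, p.Prime ∧ p ≠ q := fun p hp =>
        ⟨hS p (Finset.mem_of_mem_erase hp), Finset.ne_of_mem_erase hp⟩
      calc R ≤ ∏ p ∈ (S.erase q).subtype fun p => p.Prime ∧ p ≠ q, f p :=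
            tprod_le_prod_of_le_one (fun p => one_sub_mul_tsum_subtype_nonneg p.2.1 _)
              (fun p => sub_le_self _ (mul_nonneg (one_sub_one_div_nonneg p.2.1)
                (tsum_nonneg fun _ => by positivity))) _
        _ = ∏ p ∈ S.erase q, f p := Finset.prod_subtype_of_mem f hmem
        _ ≤ _ := by
            refine Finset.prod_le_prod
              (fun p hp => one_sub_mul_tsum_subtype_nonneg (hmem p hp).1 _) fun p hp => ?_
            obtain ⟨hp, hpq⟩ := hmem p hp
            refine one_sub_mul_tsum_subtype_le_localDensity hp ?_
            rw [allowedExponents, if_neg hpq]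
            exact Set.compl_subset_compl.2 (hT p hp hpq)
    rw [← Finset.mul_prod_erase S _ hqS] at hd'
    simp only [allowedExponents, if_true] at hd'
    rw [localDensity_singleton_zero] at hd'
    have := mul_le_mul_of_nonneg_left hprod (one_sub_one_div_nonneg hq)
    simp only [allowedExponents] at this
    linarith
  have hlim : Tendsto (fun P : ℕ => 1 - (1 - 1 / (q : ℝ)) * R + 1 / (P : ℝ)) atTop
      (𝓝 (1 - (1 - 1 / (q : ℝ)) * R + 0)) :=
    tendsto_const_nhds.add tendsto_one_div_atTop_nhds_zero_nat
  rw [add_zero] at hlim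
  exact ge_of_tendsto hlim ((eventually_ge_atTop q).mono hbound)
end

section
/- Let q be a prime and suppose that for each prime p ≠ q a set B(p) ⊇ M^c(q) of nonnegative integers is given. Then d(q) ≥ 1 - (1 - 1/q) · ∏_{p prime, p ≠ q} [(1 - 1/p) · Σ_{b ∈ B(p)} 1/p^b]. -/
open Filter Topology

open Classical in
/-- `P` is periodic modulo `m`, and a proportion `δ` of the residues modulo `m` satisfies `P`. -/
def HasPeriodicDensity (P : ℕ → Prop) (m : ℕ) (δ : ℝ) : Prop :=
  Function.Periodic P m ∧ (((Finset.range m).filter P).card : ℝ) = δ * m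

theorem card_filter_Icc_of_periodic {P : ℕ → Prop} [DecidablePred P] {m : ℕ} (hP : Function.Periodic P m) :
    ((Finset.Icc 1 m).filter P).card = ((Finset.range m).filter P).card := by
  have h := Nat.filter_Ico_card_eq_of_periodic 1 m P hP
  rw [Nat.count_eq_card_filter_range] at h
  rw [← h]
  congr 2
  ext x
  simp only [Finset.mem_Icc, Finset.mem_Ico]
  omega

theorem hasPeriodicDensity_iff_range {P : ℕ → Prop} [DecidablePred P] {m : ℕ} {δ : ℝ} :
    HasPeriodicDensity P m δ ↔
      Function.Periodic P m ∧ (((Finset.range m).filter P).card : ℝ) = δ * m := by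
  unfold HasPeriodicDensity
  refine and_congr_right fun _ => ?_
  congr!

theorem hasPeriodicDensity_iff_Icc {P : ℕ → Prop} [DecidablePred P] {m : ℕ} {δ : ℝ} :
    HasPeriodicDensity P m δ ↔
      Function.Periodic P m ∧ (((Finset.Icc 1 m).filter P).card : ℝ) = δ * m := by
  rw [hasPeriodicDensity_iff_range]
  exact and_congr_right fun h => by rw [card_filter_Icc_of_periodic h]

open Classical in
theorem HasPeriodicDensity.card_Icc_mul {P : ℕ → Prop} {m : ℕ} {δ : ℝ}
    (h : HasPeriodicDensity P m δ) (k : ℕ) :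
    (((Finset.Icc 1 (k * m)).filter P).card : ℝ) = δ * (k * m) := by
  have hper : ∀ k : ℕ, Function.Periodic P (k * m) := fun k => by
    simpa using h.1.nsmul k
  have hcount : ∀ k : ℕ, Nat.count P (k * m) = k * Nat.count P m := by
    intro k
    induction k with
    | zero => simp
    | succ k ih =>
      have hshift : (fun x => P (k * m + x)) = P := by
        funext x
        rw [add_comm]
        exact hper k x
      rw [add_mul, one_mul, Nat.count_add, ih]
      simp only [hshift]
      ring
  rw [card_filter_Icc_of_periodic (hper k), ← Nat.count_eq_card_filter_range, hcount,
    Nat.count_eq_card_filter_range, Nat.cast_mul, h.2]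
  ring

/-- Periodic conditions with coprime periods are independent. -/
theorem HasPeriodicDensity.and {P R : ℕ → Prop} {a b : ℕ} {δ ε : ℝ}
    (hP : HasPeriodicDensity P a δ) (hR : HasPeriodicDensity R b ε)
    (ha : 0 < a) (hb : 0 < b) (hab : a.Coprime b) :
    HasPeriodicDensity (fun n => P n ∧ R n) (a * b) (δ * ε) := by
  classical
  refine hasPeriodicDensity_iff_range.2 ⟨?_, ?_⟩
  · intro x
    have h1 : P (x + a * b) = P x := by
      simpa [mul_comm] using (hP.1.nsmul b) x
    have h2 : R (x + a * b) = R x := by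
      simpa using (hR.1.nsmul a) x
    simp only [h1, h2]
  · have hcard : ((Finset.range (a * b)).filter fun n => P n ∧ R n).card =
        (((Finset.range a).filter P) ×ˢ ((Finset.range b).filter R)).card := by
      refine Finset.card_bij (fun n _ => (n % a, n % b)) ?_ ?_ ?_
      · intro n hn
        simp only [Finset.mem_filter, Finset.mem_product, Finset.mem_range] at hn ⊢
        rw [hP.1.map_mod_nat, hR.1.map_mod_nat]
        exact ⟨⟨Nat.mod_lt _ ha, hn.2.1⟩, Nat.mod_lt _ hb, hn.2.2⟩
      · intro n hn n' hn' h
        simp only [Finset.mem_filter, Finset.mem_range] at hn hn'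
        simp only [Prod.mk.injEq] at h
        have hmod : n ≡ n' [MOD a * b] :=
          (Nat.modEq_and_modEq_iff_modEq_mul hab).1 ⟨h.1, h.2⟩
        exact Nat.ModEq.eq_of_lt_of_lt hmod hn.1 hn'.1
      · rintro ⟨x, y⟩ hxy
        simp only [Finset.mem_filter, Finset.mem_product, Finset.mem_range] at hxy
        obtain ⟨⟨hxa, hx⟩, hyb, hy⟩ := hxy
        obtain ⟨z, hzx, hzy⟩ := Nat.chineseRemainder hab x y
        have hza : z % (a * b) % a = x := by
          rw [Nat.mod_mul_right_mod, hzx, Nat.mod_eq_of_lt hxa]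
        have hzb : z % (a * b) % b = y := by
          rw [Nat.mod_mul_left_mod, hzy, Nat.mod_eq_of_lt hyb]
        refine ⟨z % (a * b), ?_, by rw [hza, hzb]⟩
        simp only [Finset.mem_filter, Finset.mem_range]
        refine ⟨Nat.mod_lt _ (by positivity), ?_, ?_⟩
        · rwa [← hP.1.map_mod_nat, hza]
        · rwa [← hR.1.map_mod_nat, hzb]
    rw [hcard, Finset.card_product, Nat.cast_mul, hP.2, hR.2]
    push_cast
    ring

theorem hasPeriodicDensity_true : HasPeriodicDensity (fun _ => True) 1 1 :=
  ⟨fun _ => rfl, by simp⟩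

theorem HasPeriodicDensity.forall_finset {ι : Type*} {P : ι → ℕ → Prop} {m : ι → ℕ} {δ : ι → ℝ}
    (s : Finset ι) (h : ∀ i ∈ s, HasPeriodicDensity (P i) (m i) (δ i)) (hm : ∀ i ∈ s, 0 < m i)
    (hco : (s : Set ι).Pairwise fun i j => (m i).Coprime (m j)) :
    HasPeriodicDensity (fun n => ∀ i ∈ s, P i n) (∏ i ∈ s, m i) (∏ i ∈ s, δ i) := by
  classical
  induction s using Finset.induction_on with
  | empty => simpa using hasPeriodicDensity_true
  | insert j s hj ih =>
    simp only [Finset.forall_mem_insert] at h hm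
    rw [Finset.prod_insert hj, Finset.prod_insert hj]
    simp only [Finset.forall_mem_insert]
    refine h.1.and (ih h.2 hm.2 (hco.mono (by simp))) hm.1 (Finset.prod_pos hm.2)
      (Nat.Coprime.prod_right fun i hi => hco (by simp) (by simp [hi]) ?_)
    rintro rfl
    exact hj hi

theorem periodic_dvd {a m : ℕ} (h : a ∣ m) : Function.Periodic (fun n => a ∣ n) m := fun _ =>
  propext (Nat.dvd_add_iff_left h).symm

theorem card_filter_dvd_Icc (a m : ℕ) : ((Finset.Icc 1 m).filter fun n => a ∣ n).card = m / a := by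
  exact Nat.Ioc_filter_dvd_card_eq_div m a

theorem hasPeriodicDensity_not_dvd {q : ℕ} (hq : 0 < q) :
    HasPeriodicDensity (fun n => ¬ q ∣ n) q (1 - 1 / (q : ℝ)) := by
  classical
  have hper : Function.Periodic (fun n => ¬ q ∣ n) q := fun n => by
    have := periodic_dvd (dvd_refl q) n
    simp only [this]
  refine hasPeriodicDensity_iff_Icc.2 ⟨hper, ?_⟩
  have h := Finset.card_filter_add_card_filter_not (s := Finset.Icc 1 q) (fun n => q ∣ n)
  rw [card_filter_dvd_Icc, Nat.div_self hq, Nat.card_Icc, Nat.add_sub_cancel] at h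
  have h' : (1 : ℝ) + (((Finset.Icc 1 q).filter fun n => ¬ q ∣ n).card : ℝ) = q := by
    exact_mod_cast h
  have : (q : ℝ) ≠ 0 := by positivity
  field_simp
  linarith

open Classical in
/-- The density of the integers whose `p`-adic valuation does not lie in `{b < K | b ∉ B}`. -/
theorem hasPeriodicDensity_valuation {p : ℕ} (hp : 1 < p) (B : Set ℕ) (K : ℕ) :
    HasPeriodicDensity (fun n => ∀ b < K, b ∉ B → ¬ (p ^ b ∣ n ∧ ¬ p ^ (b + 1) ∣ n)) (p ^ K)
      (1 - (1 - 1 / (p : ℝ)) * ∑ b ∈ Finset.range K, Bᶜ.indicator (fun b => 1 / (p : ℝ) ^ b) b) := by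
  have hp0 : (p : ℝ) ≠ 0 := by positivity
  have hdvd : ∀ b ≤ K, p ^ b ∣ p ^ K := fun b hb => pow_dvd_pow p hb
  have hper : Function.Periodic
      (fun n => ∀ b < K, b ∉ B → ¬ (p ^ b ∣ n ∧ ¬ p ^ (b + 1) ∣ n)) (p ^ K) := by
    intro n
    refine propext (forall₂_congr fun b hb => ?_)
    rw [← Nat.dvd_add_iff_left (hdvd b hb.le), ← Nat.dvd_add_iff_left (hdvd (b + 1) hb)]
  refine hasPeriodicDensity_iff_Icc.2 ⟨hper, ?_⟩
  have hlayer : ∀ b < K, ((((Finset.Icc 1 (p ^ K)).filter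
      fun n => p ^ b ∣ n ∧ ¬ p ^ (b + 1) ∣ n).card : ℕ) : ℝ) =
      (1 - 1 / (p : ℝ)) * (1 / (p : ℝ) ^ b) * (p : ℝ) ^ K := by
    intro b hb
    have hsdiff : (Finset.Icc 1 (p ^ K)).filter (fun n => p ^ b ∣ n ∧ ¬ p ^ (b + 1) ∣ n) =
        (Finset.Icc 1 (p ^ K)).filter (fun n => p ^ b ∣ n) \
          (Finset.Icc 1 (p ^ K)).filter (fun n => p ^ (b + 1) ∣ n) := by
      ext n
      simp only [Finset.mem_filter, Finset.mem_sdiff]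
      tauto
    have hsub : (Finset.Icc 1 (p ^ K)).filter (fun n => p ^ (b + 1) ∣ n) ⊆
        (Finset.Icc 1 (p ^ K)).filter (fun n => p ^ b ∣ n) :=
      Finset.monotone_filter_right _ fun _ _ hn => (pow_dvd_pow p b.le_succ).trans hn
    rw [hsdiff, Finset.cast_card_sdiff hsub, card_filter_dvd_Icc, card_filter_dvd_Icc,
      Nat.cast_div (hdvd b hb.le) (by positivity), Nat.cast_div (hdvd (b + 1) hb) (by positivity)]
    push_cast
    field_simp
    ring
  have hcompl : (Finset.Icc 1 (p ^ K)).filter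
      (fun n => ¬ ∀ b < K, b ∉ B → ¬ (p ^ b ∣ n ∧ ¬ p ^ (b + 1) ∣ n)) =
      ((Finset.range K).filter (· ∉ B)).biUnion fun b =>
        (Finset.Icc 1 (p ^ K)).filter fun n => p ^ b ∣ n ∧ ¬ p ^ (b + 1) ∣ n := by
    ext n
    simp only [Finset.mem_filter, Finset.mem_biUnion, Finset.mem_range]
    push Not
    constructor
    · rintro ⟨hn, b, hb, hbB, h⟩
      exact ⟨b, ⟨hb, hbB⟩, hn, h⟩
    · rintro ⟨b, ⟨hb, hbB⟩, hn, h⟩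
      exact ⟨hn, b, hb, hbB, h⟩
  have hdisj : (((Finset.range K).filter (· ∉ B) : Finset ℕ) : Set ℕ).PairwiseDisjoint fun b =>
      (Finset.Icc 1 (p ^ K)).filter fun n => p ^ b ∣ n ∧ ¬ p ^ (b + 1) ∣ n := by
    intro b _ c _ hbc
    refine Finset.disjoint_left.2 fun n hnb hnc => ?_
    simp only [Finset.mem_filter] at hnb hnc
    rcases lt_or_gt_of_ne hbc with h | h
    · exact hnb.2.2 ((pow_dvd_pow p h).trans hnc.2.1)
    · exact hnc.2.2 ((pow_dvd_pow p h).trans hnb.2.1)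
  have hcard := Finset.card_filter_add_card_filter_not (s := Finset.Icc 1 (p ^ K))
    (fun n => ∀ b < K, b ∉ B → ¬ (p ^ b ∣ n ∧ ¬ p ^ (b + 1) ∣ n))
  rw [hcompl, Finset.card_biUnion hdisj, Nat.card_Icc, Nat.add_sub_cancel] at hcard
  have hsum : (∑ b ∈ (Finset.range K).filter (· ∉ B), ((((Finset.Icc 1 (p ^ K)).filter
      fun n => p ^ b ∣ n ∧ ¬ p ^ (b + 1) ∣ n).card : ℕ) : ℝ)) =
      (1 - 1 / (p : ℝ)) * (∑ b ∈ Finset.range K,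
        Bᶜ.indicator (fun b => 1 / (p : ℝ) ^ b) b) * (p : ℝ) ^ K := by
    rw [Finset.sum_congr rfl fun b hb =>
      hlayer b (Finset.mem_range.1 (Finset.mem_filter.1 hb).1), Finset.sum_filter,
      Finset.mul_sum, Finset.sum_mul]
    refine Finset.sum_congr rfl fun b _ => ?_
    by_cases hb : b ∈ B <;> simp [hb]
  have hcard' := congrArg (Nat.cast : ℕ → ℝ) hcard
  push_cast at hcard'
  rw [hsum] at hcard'
  push_cast
  linarith

theorem geometric_factor_eq {p : ℕ} (hp : 1 < p) (B : Set ℕ) :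
    (1 - 1 / (p : ℝ)) * ∑' b : B, 1 / (p : ℝ) ^ (b : ℕ) =
      1 - (1 - 1 / (p : ℝ)) * ∑' b, Bᶜ.indicator (fun b => 1 / (p : ℝ) ^ b) b := by
  have hp' : (1 : ℝ) < p := by exact_mod_cast hp
  have hlt : 1 / (p : ℝ) < 1 := (div_lt_one (by positivity)).2 hp'
  have hgeom : HasSum (fun b : ℕ => 1 / (p : ℝ) ^ b) (1 - 1 / (p : ℝ))⁻¹ := by
    simpa using hasSum_geometric_of_lt_one (by positivity) hlt
  have h := hgeom.summable.tsum_subtype_add_tsum_subtype_compl B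
  rw [tsum_subtype Bᶜ (fun b : ℕ => 1 / (p : ℝ) ^ b), hgeom.tsum_eq] at h
  have hne : 1 - 1 / (p : ℝ) ≠ 0 := by linarith
  have h' := congrArg (fun x => (1 - 1 / (p : ℝ)) * x) h
  simp only [mul_add, mul_inv_cancel₀ hne] at h'
  linarith

theorem tendsto_geometric_factor {p : ℕ} (hp : 1 < p) (B : Set ℕ) :
    Tendsto (fun K => 1 - (1 - 1 / (p : ℝ)) *
      ∑ b ∈ Finset.range K, Bᶜ.indicator (fun b => 1 / (p : ℝ) ^ b) b) atTop
      (𝓝 ((1 - 1 / (p : ℝ)) * ∑' b : B, 1 / (p : ℝ) ^ (b : ℕ))) := by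
  have hp' : (1 : ℝ) < p := by exact_mod_cast hp
  have hlt : 1 / (p : ℝ) < 1 := (div_lt_one (by positivity)).2 hp'
  have hsum : Summable (fun b : ℕ => 1 / (p : ℝ) ^ b) := by
    simpa using summable_geometric_of_lt_one (by positivity) hlt
  rw [geometric_factor_eq hp]
  exact ((hsum.indicator Bᶜ).hasSum.tendsto_sum_nat.const_mul _).const_sub _

theorem geometric_factor_nonneg {p : ℕ} (hp : 1 < p) (B : Set ℕ) :
    0 ≤ (1 - 1 / (p : ℝ)) * ∑' b : B, 1 / (p : ℝ) ^ (b : ℕ) := by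
  have hp' : (1 : ℝ) < p := by exact_mod_cast hp
  have hlt : 1 / (p : ℝ) < 1 := (div_lt_one (by positivity)).2 hp'
  exact mul_nonneg (by linarith) (tsum_nonneg fun b => by positivity)

theorem geometric_factor_le_one {p : ℕ} (hp : 1 < p) (B : Set ℕ) :
    (1 - 1 / (p : ℝ)) * ∑' b : B, 1 / (p : ℝ) ^ (b : ℕ) ≤ 1 := by
  have hp' : (1 : ℝ) < p := by exact_mod_cast hp
  have hlt : 1 / (p : ℝ) < 1 := (div_lt_one (by positivity)).2 hp'
  rw [geometric_factor_eq hp]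
  have : 0 ≤ (1 - 1 / (p : ℝ)) * ∑' b, Bᶜ.indicator (fun b => 1 / (p : ℝ) ^ b) b :=
    mul_nonneg (by linarith) (tsum_nonneg fun b => Set.indicator_nonneg (fun _ _ => by positivity) b)
  linarith

/-- An infinite product of reals in `[0, 1]` converges to the infimum of its finite subproducts. -/
theorem hasProd_ciInf_of_le_one {ι : Type*} {f : ι → ℝ} (h0 : ∀ i, 0 ≤ f i) (h1 : ∀ i, f i ≤ 1) :
    HasProd f (⨅ s : Finset ι, ∏ i ∈ s, f i) := by
  refine tendsto_atTop_ciInf (fun s t hst => ?_) ⟨0, ?_⟩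
  · exact Finset.prod_le_prod_of_subset_of_le_one hst (fun i _ => h0 i) fun i _ _ => h1 i
  · rintro _ ⟨s, rfl⟩
    exact Finset.prod_nonneg fun i _ => h0 i

theorem factorization_mem_of_not_towerMem {q n p b : ℕ} (hn : 1 ≤ n) (h : ¬ TowerMem q n)
    (hp : p.Prime) (hb : p ^ b ∣ n) (hb' : ¬ p ^ (b + 1) ∣ n) : ¬ TowerMem q b := by
  intro hbq
  have hpn : p ∣ n := (dvd_pow_self p (by have := hbq.two_le; omega)).trans hb
  have hfac : n.factorization p = b := by
    have h1 := (hp.pow_dvd_iff_le_factorization (by omega)).1 hb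
    have h2 := mt (hp.pow_dvd_iff_le_factorization (by omega)).2 hb'
    omega
  exact h (.step n p (hp.two_le.trans (Nat.le_of_dvd hn hpn)) hp hpn (hfac ▸ hbq))

/-- A condition satisfied by every positive integer outside `M(q)` bounds its density. -/
theorem one_sub_le_of_hasPeriodicDensity {q m : ℕ} {d δ : ℝ} {P : ℕ → Prop}
    (hd : Tendsto (towerRatio q) atTop (𝓝 d)) (hm : 0 < m) (hP : HasPeriodicDensity P m δ)
    (hsub : ∀ n, 1 ≤ n → ¬ TowerMem q n → P n) : 1 - d ≤ δ := by
  classical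
  have hlim : Tendsto (fun k : ℕ => 1 - towerRatio q (k * m)) atTop (𝓝 (1 - d)) :=
    (hd.comp (tendsto_id.atTop_mul_const' hm)).const_sub 1
  refine le_of_tendsto hlim ?_
  filter_upwards [eventually_gt_atTop 0] with k hk
  have hcard := Finset.card_filter_add_card_filter_not (s := Finset.Icc 1 (k * m)) (TowerMem q)
  rw [Nat.card_Icc, Nat.add_sub_cancel] at hcard
  have hle : ((Finset.Icc 1 (k * m)).filter fun n => ¬ TowerMem q n).card ≤
      ((Finset.Icc 1 (k * m)).filter P).card :=
    Finset.card_le_card (Finset.monotone_filter_right _ fun n hn h =>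
      hsub n (Finset.mem_Icc.1 hn).1 h)
  have hle' : ((((Finset.Icc 1 (k * m)).filter fun n => ¬ TowerMem q n).card : ℕ) : ℝ) ≤
      δ * (k * m) := by
    rw [← hP.card_Icc_mul k]
    exact_mod_cast hle
  have hcard' := congrArg (Nat.cast : ℕ → ℝ) hcard
  push_cast at hcard'
  have hpos : (0 : ℝ) < (k : ℝ) * m := by positivity
  unfold towerRatio
  push_cast
  rw [sub_le_iff_le_add, ← sub_le_iff_le_add', le_div_iff₀ hpos]
  linarith


theorem tower_density_lower_bound_compl_supersets (q : ℕ) (hq : q.Prime)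
    (B : ℕ → Set ℕ) (hB : ∀ p : ℕ, p.Prime → p ≠ q → {m | ¬ TowerMem q m} ⊆ B p)
    (d : ℝ) (hd : Tendsto (towerRatio q) atTop (𝓝 d)) :
    d ≥ 1 - (1 - 1 / (q : ℝ)) *
      ∏' p : {p : ℕ // p.Prime ∧ p ≠ q},
        ((1 - 1 / ((p : ℕ) : ℝ)) *
          ∑' b : B (p : ℕ), 1 / ((p : ℕ) : ℝ) ^ (b : ℕ)) := by
  set f : {p : ℕ // p.Prime ∧ p ≠ q} → ℝ := fun p =>
    (1 - 1 / ((p : ℕ) : ℝ)) * ∑' b : B (p : ℕ), 1 / ((p : ℕ) : ℝ) ^ (b : ℕ)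
  have hf0 : ∀ p, 0 ≤ f p := fun p => geometric_factor_nonneg p.2.1.one_lt _
  have hf1 : ∀ p, f p ≤ 1 := fun p => geometric_factor_le_one p.2.1.one_lt _
  have hfinite : ∀ s : Finset {p : ℕ // p.Prime ∧ p ≠ q},
      1 - d ≤ (1 - 1 / (q : ℝ)) * ∏ p ∈ s, f p := by
    intro s
    have hlim := (tendsto_finsetProd s fun p _ =>
      tendsto_geometric_factor p.2.1.one_lt (B p)).const_mul (1 - 1 / (q : ℝ))
    refine ge_of_tendsto' hlim fun K => ?_
    have hpos : ∀ p ∈ s, 0 < (p : ℕ) ^ K := fun p _ => pow_pos p.2.1.pos K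
    have hdens := (hasPeriodicDensity_not_dvd hq.pos).and
      (HasPeriodicDensity.forall_finset s
        (fun p _ => hasPeriodicDensity_valuation p.2.1.one_lt (B p) K) hpos
        fun p _ r _ hpr => Nat.Coprime.pow K K
          ((Nat.coprime_primes p.2.1 r.2.1).2 (Subtype.coe_injective.ne hpr)))
      hq.pos (Finset.prod_pos hpos)
      (Nat.Coprime.prod_right fun p _ => Nat.Coprime.pow_right K
        ((Nat.coprime_primes hq p.2.1).2 p.2.2.symm))
    refine one_sub_le_of_hasPeriodicDensity hd (mul_pos hq.pos (Finset.prod_pos hpos)) hdens ?_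
    intro n hn hnM
    refine ⟨fun hqn => hnM (.base n (hq.two_le.trans (Nat.le_of_dvd hn hqn)) hqn), ?_⟩
    rintro p - b - hbB ⟨hb, hb'⟩
    exact hbB (hB p p.2.1 p.2.2 (factorization_mem_of_not_towerMem hn hnM p.2.1 hb hb'))
  have hprod : HasProd f (∏' p, f p) := (hasProd_ciInf_of_le_one hf0 hf1).multipliable.hasProd
  have := ge_of_tendsto' (Tendsto.const_mul (1 - 1 / (q : ℝ)) hprod) hfinite
  linarith
end

section
/- Let q be a prime, let P be a finite set of primes with q ∉ P, and let S ⊆ M(q). Then d(q) ≥ 1 - (1 - 1/q) · ∏_{p ∈ P} [1 - (1 - 1/p) · Σ_{s ∈ S} 1/p^s]. -/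
open Filter Topology

open Classical in
/-- The set `X` has natural density `δ`, computed over the positive integers. -/
def HasNatDensity (X : Set ℕ) (δ : ℝ) : Prop :=
  Tendsto (fun N : ℕ => (((Finset.Icc 1 N).filter fun n => n ∈ X).card : ℝ) / (N : ℝ))
    atTop (𝓝 δ)

namespace HasNatDensity

theorem univ : HasNatDensity Set.univ 1 := by
  refine tendsto_const_nhds.congr' ?_
  filter_upwards [eventually_gt_atTop 0] with N hN
  have : (N : ℝ) ≠ 0 := by positivity
  simp [this]

theorem diff {X Y : Set ℕ} {a b : ℝ} (hX : HasNatDensity X a) (hY : HasNatDensity Y b)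
    (hYX : Y ⊆ X) : HasNatDensity (X \ Y) (a - b) := by
  classical
  refine (Tendsto.sub hX hY).congr fun N => ?_
  rw [← sub_div]
  congr 1
  have hsub : (Finset.Icc 1 N).filter (· ∈ Y) ⊆ (Finset.Icc 1 N).filter (· ∈ X) :=
    Finset.monotone_filter_right _ fun _ _ h => hYX h
  have hsd : (Finset.Icc 1 N).filter (· ∈ X \ Y) =
      (Finset.Icc 1 N).filter (· ∈ X) \ (Finset.Icc 1 N).filter (· ∈ Y) := by
    ext n
    simp only [Finset.mem_filter, Finset.mem_sdiff, Set.mem_sdiff]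
    tauto
  rw [← Finset.cast_card_sdiff hsub, ← hsd]
  congr!

theorem le {X Y : Set ℕ} {a b : ℝ} (hX : HasNatDensity X a) (hY : HasNatDensity Y b)
    (hXY : ∀ n ≠ 0, n ∈ X → n ∈ Y) : a ≤ b := by
  classical
  refine le_of_tendsto_of_tendsto' hX hY fun N => ?_
  have hsub : ∀ n ∈ Finset.Icc 1 N, n ∈ X → n ∈ Y := fun n hn =>
    hXY n (Nat.one_le_iff_ne_zero.1 (Finset.mem_Icc.1 hn).1)
  gcongr 2
  exact Finset.card_le_card fun n hn => by
    rw [Finset.mem_filter] at hn ⊢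
    exact ⟨hn.1, hsub n hn.1 hn.2⟩

/-- If `X` is invariant under multiplication by `k`, then the multiples of `k` in `X` make up
a proportion `1 / k` of `X`. -/
theorem multiples {X : Set ℕ} {a : ℝ} (hX : HasNatDensity X a) {k : ℕ} (hk : 0 < k)
    (hinv : ∀ m ≠ 0, k * m ∈ X ↔ m ∈ X) : HasNatDensity {n ∈ X | k ∣ n} (a * (1 / k)) := by
  classical
  have hdiv : Tendsto (fun N : ℕ => N / k) atTop atTop := Nat.tendsto_div_const_atTop hk.ne'
  have hratio : Tendsto (fun N : ℕ => ((N / k : ℕ) : ℝ) / N) atTop (𝓝 (1 / k)) := by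
    refine ((tendsto_nat_floor_mul_div_atTop (R := ℝ) (a := 1 / k) (by positivity)).comp
      tendsto_natCast_atTop_atTop).congr fun N => ?_
    simp only [Function.comp_apply]
    rw [one_div_mul_eq_div, Nat.floor_div_eq_div]
  refine ((Tendsto.comp hX hdiv).mul hratio).congr' ?_
  filter_upwards [hdiv.eventually_gt_atTop 0] with N hN
  have h0 : ((N / k : ℕ) : ℝ) ≠ 0 := by exact_mod_cast hN.ne'
  simp only [Function.comp_apply]
  rw [div_mul_div_cancel₀ h0]
  congr 2
  refine Finset.card_bij (fun m _ => k * m) ?_ ?_ ?_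
  · intro m hm
    simp only [Finset.mem_filter, Finset.mem_Icc] at hm
    obtain ⟨⟨h1, h2⟩, h3⟩ := hm
    simp only [Finset.mem_filter, Finset.mem_Icc]
    exact ⟨⟨Nat.mul_pos hk h1, (mul_comm k m).trans_le ((Nat.le_div_iff_mul_le hk).1 h2)⟩,
      (hinv m (by omega)).2 h3, dvd_mul_right k m⟩
  · intro m _ m' _ h
    exact Nat.eq_of_mul_eq_mul_left hk h
  · intro n hn
    simp only [Finset.mem_filter, Finset.mem_Icc] at hn
    obtain ⟨⟨h1, h2⟩, h3, m, rfl⟩ := hn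
    have hm : m ≠ 0 := by rintro rfl; simp at h1
    refine ⟨m, ?_, rfl⟩
    simp only [Finset.mem_filter, Finset.mem_Icc]
    exact ⟨⟨by omega, (Nat.le_div_iff_mul_le hk).2 ((mul_comm m k).trans_le h2)⟩,
      (hinv m hm).1 h3⟩

theorem congr {X Y : Set ℕ} {a : ℝ} (hX : HasNatDensity X a)
    (h : ∀ n ≠ 0, n ∈ X ↔ n ∈ Y) : HasNatDensity Y a := by
  classical
  refine Tendsto.congr (fun N => ?_) hX
  congr 2
  refine congrArg _ ?_
  exact Finset.filter_congr fun n hn =>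
    h n (Nat.one_le_iff_ne_zero.1 (Finset.mem_Icc.1 hn).1)

theorem factorization_eq {X : Set ℕ} {a : ℝ} (hX : HasNatDensity X a) {p : ℕ} (hp : p.Prime)
    (hinv : ∀ m ≠ 0, p * m ∈ X ↔ m ∈ X) (s : ℕ) :
    HasNatDensity {n ∈ X | n.factorization p = s} (a * ((1 - 1 / p) * (1 / p ^ s))) := by
  have hpow : ∀ t, ∀ m ≠ 0, p ^ t * m ∈ X ↔ m ∈ X := by
    intro t
    induction t with
    | zero => simp
    | succ t ih =>
      intro m hm
      rw [pow_succ, mul_assoc, ih _ (mul_ne_zero hp.ne_zero hm), hinv m hm]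
  have hdiff := (hX.multiples (pow_pos hp.pos s) (hpow s)).diff
    (hX.multiples (pow_pos hp.pos (s + 1)) (hpow (s + 1)))
    fun n hn => ⟨hn.1, (pow_dvd_pow p s.le_succ).trans hn.2⟩
  have hp0 : (p : ℝ) ≠ 0 := by exact_mod_cast hp.ne_zero
  have hval : a * (1 / ((p ^ s : ℕ) : ℝ)) - a * (1 / ((p ^ (s + 1) : ℕ) : ℝ)) =
      a * ((1 - 1 / p) * (1 / p ^ s)) := by
    push_cast
    field_simp
    ring
  rw [← hval]
  refine hdiff.congr fun n hn => ?_
  simp only [Set.mem_sdiff, Set.mem_ofPred_eq, hp.pow_dvd_iff_le_factorization hn]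
  grind

theorem factorization_notMem {X : Set ℕ} {a : ℝ} (hX : HasNatDensity X a) {p : ℕ}
    (hp : p.Prime) (hinv : ∀ m ≠ 0, p * m ∈ X ↔ m ∈ X) (F : Finset ℕ) :
    HasNatDensity {n ∈ X | n.factorization p ∉ F}
      (a * (1 - (1 - 1 / p) * ∑ s ∈ F, 1 / (p : ℝ) ^ s)) := by
  induction F using Finset.induction_on with
  | empty => simpa using hX
  | insert s F hs ih =>
    have hdiff := ih.diff (hX.factorization_eq hp hinv s)
      fun n hn => ⟨hn.1, by rw [hn.2]; exact hs⟩
    have hval : a * (1 - (1 - 1 / p) * ∑ s ∈ insert s F, 1 / (p : ℝ) ^ s) =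
        a * (1 - (1 - 1 / p) * ∑ s ∈ F, 1 / (p : ℝ) ^ s) - a * ((1 - 1 / p) * (1 / p ^ s)) := by
      rw [Finset.sum_insert hs]
      ring
    rw [hval]
    refine hdiff.congr fun n _ => ?_
    simp only [Set.mem_sdiff, Set.mem_ofPred_eq, Finset.mem_insert]
    tauto

end HasNatDensity

theorem hasNatDensity_forall_factorization_notMem {q : ℕ} (hq : q.Prime) (F P : Finset ℕ)
    (hP : ∀ p ∈ P, Nat.Prime p) (hqP : q ∉ P) :
    HasNatDensity {n | n.factorization q = 0 ∧ ∀ p ∈ P, n.factorization p ∉ F}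
      ((1 - 1 / (q : ℝ)) * ∏ p ∈ P, (1 - (1 - 1 / (p : ℝ)) * ∑ s ∈ F, 1 / (p : ℝ) ^ s)) := by
  induction P using Finset.induction_on with
  | empty => simpa using HasNatDensity.univ.factorization_eq hq (by simp) 0
  | insert p P hpP ih =>
    have hp : p.Prime := hP p (Finset.mem_insert_self p P)
    have hmul : ∀ r ≠ p, ∀ m ≠ 0, (p * m).factorization r = m.factorization r := by
      intro r hr m hm
      simp [Nat.factorization_mul hp.ne_zero hm, hp.factorization, hr.symm]
    have h := (ih (fun r hr => hP r (Finset.mem_insert_of_mem hr))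
      (fun hr => hqP (Finset.mem_insert_of_mem hr))).factorization_notMem hp (fun m hm => by
        simp only [Set.mem_ofPred_eq]
        rw [hmul q (fun h => hqP (h ▸ Finset.mem_insert_self p P)) m hm]
        refine and_congr_right fun _ => forall₂_congr fun r hr => ?_
        rw [hmul r (fun h => hpP (h ▸ hr)) m hm]) F
    rw [Finset.prod_insert hpP, mul_comm (1 - (1 - 1 / (p : ℝ)) * _), ← mul_assoc]
    refine h.congr fun n _ => ?_
    simp only [Set.mem_ofPred_eq, Finset.forall_mem_insert]
    tauto

theorem TowerMem.of_dvd {q n : ℕ} (hq : q.Prime) (hn : n ≠ 0) (h : q ∣ n) : TowerMem q n :=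
  .base n (hq.two_le.trans (Nat.le_of_dvd (Nat.pos_of_ne_zero hn) h)) h

theorem TowerMem.of_factorization {q n p : ℕ} (hp : p.Prime) (hn : n ≠ 0)
    (h : TowerMem q (n.factorization p)) : TowerMem q n := by
  have hdvd : p ∣ n := Nat.dvd_of_factorization_pos (by have := h.two_le; omega)
  exact .step n p (hp.two_le.trans (Nat.le_of_dvd (Nat.pos_of_ne_zero hn) hdvd)) hp hdvd h

theorem tower_density_lower_bound_finite (q : ℕ) (hq : q.Prime)
    (P : Finset ℕ) (hP : ∀ p ∈ P, Nat.Prime p) (hqP : q ∉ P)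
    (S : Set ℕ) (hS : S ⊆ {m | TowerMem q m})
    (d : ℝ) (hd : Tendsto (towerRatio q) atTop (𝓝 d)) :
    d ≥ 1 - (1 - 1 / (q : ℝ)) *
      ∏ p ∈ P, (1 - (1 - 1 / (p : ℝ)) * ∑' s : S, 1 / (p : ℝ) ^ (s : ℕ)) := by
  have hfin (F : Finset S) : 1 - (1 - 1 / (q : ℝ)) *
      ∏ p ∈ P, (1 - (1 - 1 / (p : ℝ)) * ∑ s ∈ F, 1 / (p : ℝ) ^ (s : ℕ)) ≤ d := by
    have h := HasNatDensity.univ.diff (hasNatDensity_forall_factorization_notMem hq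
      (F.map (Function.Embedding.subtype _)) P hP hqP) (Set.subset_univ _)
    simp only [Finset.sum_map, Function.Embedding.subtype_apply] at h
    refine h.le (Y := {n | TowerMem q n}) hd fun n hn hnX => ?_
    by_contra hnot
    refine hnX.2 ⟨Nat.factorization_eq_zero_of_not_dvd fun hdvd =>
      hnot (.of_dvd hq hn hdvd), fun p hp hmem => ?_⟩
    obtain ⟨s, -, hs⟩ := Finset.mem_map.1 hmem
    refine hnot (.of_factorization (hP p hp) hn ?_)
    rw [← hs]
    exact hS s.2
  refine le_of_tendsto' (x := atTop) ?_ hfin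
  refine tendsto_const_nhds.sub (tendsto_const_nhds.mul (tendsto_finsetProd P fun p hp =>
    tendsto_const_nhds.sub (tendsto_const_nhds.mul ?_)))
  have hsum : Summable fun s : ℕ => 1 / (p : ℝ) ^ s := by
    simpa using summable_geometric_of_lt_one (r := (p : ℝ)⁻¹) (by positivity)
      (inv_lt_one_of_one_lt₀ (by exact_mod_cast (hP p hp).one_lt))
  exact (hsum.subtype S).hasSum
end
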